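/- arXiv:1604.03788 — 2 statements merged into one kernel-verified Lean document; each statement's English description precedes it below -/
import Mathlib

section
/- Let C be a finitely generated, recursively presented group: C = PresentedGroup R for some k ∈ ℕ and some subset R of the free group on k generators that is recursively enumerable (e.g., R is the range of a function f : ℕ → FreeGroup(Fin k) such that n ↦ (f n).toWord is computable). Then there exist a finitely presented group H and an injective group homomorphism ι : C → H such that the torsion lengths of C and H coincide; precisely, for every m ∈ ℕ, tor_m(C) = tor_{m+1}(C) if and only if tor_m(H) = tor_{m+1}(H). -/
/-- The ascending chain of normal subgroups `tor₀(G) = 1`,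
`tor_{n+1}(G) = ⟪elements of finite order mod tor_n(G)⟫`. -/
def tor (G : Type*) [Group G] : ℕ → Subgroup G
  | 0 => ⊥
  | n + 1 => Subgroup.normalClosure {g : G | ∃ k : ℕ, 0 < k ∧ g ^ k ∈ tor G n}

namespace HNNExtension

variable {G : Type*} [Group G] {A B : Subgroup G} {φ : A ≃* B}

/-- The product of a list of letters `t ^ u * g` in an HNN extension. -/
def wordProd (φ : A ≃* B) (l : List (ℤˣ × G)) : HNNExtension G A B φ :=
  (l.map fun x => t ^ (x.1 : ℤ) * of x.2).prod

/-- The condition that a list of letters contains no `t`-reduction. -/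
def IsReduced (A B : Subgroup G) (l : List (ℤˣ × G)) : Prop :=
  l.IsChain fun a b => a.2 ∈ toSubgroup A B a.1 → a.1 = b.1

@[simp] theorem wordProd_nil : wordProd φ [] = 1 := rfl

@[simp] theorem wordProd_cons (a : ℤˣ × G) (l : List (ℤˣ × G)) :
    wordProd φ (a :: l) = t ^ (a.1 : ℤ) * of a.2 * wordProd φ l := by
  simp [wordProd]

@[simp] theorem wordProd_append (l l' : List (ℤˣ × G)) :
    wordProd φ (l ++ l') = wordProd φ l * wordProd φ l' := by
  simp [wordProd]

theorem IsReduced.eq_nil {l : List (ℤˣ × G)} (hl : IsReduced A B l) {g h : G}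
    (h' : of g * wordProd φ l = of h) : l = [] :=
  ReducedWord.toList_eq_nil_of_mem_of_range φ ⟨g, l, hl⟩ ⟨h, h'.symm⟩

theorem exists_reduced (x : HNNExtension G A B φ) :
    ∃ (g : G) (l : List (ℤˣ × G)), IsReduced A B l ∧ of g * wordProd φ l = x := by
  obtain ⟨d⟩ := NormalWord.TransversalPair.nonempty G A B
  obtain ⟨w, rfl⟩ := (NormalWord.equiv φ d).symm.surjective x
  exact ⟨w.head, w.toList, w.chain, rfl⟩

theorem t_zpow_mul_of_mul (u : ℤˣ) (g : toSubgroup A B u) :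
    (t : HNNExtension G A B φ) ^ (u : ℤ) * of (g : G) * t ^ (-(u : ℤ)) =
      of (toSubgroupEquiv φ u g : G) := by
  rcases Int.units_eq_one_or u with rfl | rfl
  · simp only [Units.val_one, zpow_one, zpow_neg, toSubgroupEquiv_one]
    exact (equiv_eq_conj (φ := φ) g).symm
  · simp only [Units.val_neg, Units.val_one, zpow_neg, zpow_one, neg_neg]
    exact (equiv_symm_eq_conj (φ := φ) g).symm

/-- An element of finite order of an HNN extension is conjugate into the base group. -/
theorem exists_conj_of_pow_eq_one (x : HNNExtension G A B φ) {n : ℕ} (hn : 0 < n)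
    (hx : x ^ n = 1) : ∃ (y : HNNExtension G A B φ) (g : G), x = y * of g * y⁻¹ := by
  obtain ⟨g, l, hl, rfl⟩ := exists_reduced x
  induction hlen : l.length using Nat.strong_induction_on generalizing g l with
  | _ m ih =>
  subst hlen
  rcases l.eq_nil_or_concat with rfl | ⟨l₀, ⟨u, a⟩, rfl⟩
  · exact ⟨1, g, by simp⟩
  rw [List.concat_eq_append] at *
  -- conjugate so that the head becomes trivial
  have hconj : (of g * wordProd φ (l₀ ++ [(u, a)]) : HNNExtension G A B φ) =
      of g * wordProd φ (l₀ ++ [(u, a * g)]) * (of g)⁻¹ := by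
    simp [mul_assoc]
  have hl' : IsReduced A B (l₀ ++ [(u, a * g)]) := by
    unfold IsReduced at *
    rw [List.isChain_append] at hl ⊢
    simpa using hl
  have hx' : (wordProd φ (l₀ ++ [(u, a * g)])) ^ n = 1 := by
    rw [hconj, conj_pow] at hx
    simpa using hx
  by_cases hcyc : IsReduced A B ((l₀ ++ [(u, a * g)]) ++ (l₀ ++ [(u, a * g)]))
  · -- cyclically reduced words have infinite order
    exfalso
    generalize hL : l₀ ++ [(u, a * g)] = L at *
    have hLne : L ≠ [] := by rw [← hL]; simp
    have key : ∀ k : ℕ, ∃ L' : List (ℤˣ × G), IsReduced A B (L ++ L') ∧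
        wordProd φ (L ++ L') = wordProd φ L ^ (k + 1) := by
      intro k
      induction k with
      | zero => exact ⟨[], by simpa using hl', by simp⟩
      | succ k ihk =>
        obtain ⟨L', h1, h2⟩ := ihk
        refine ⟨L ++ L', ?_, by rw [wordProd_append, h2, pow_succ' _ (k + 1)]⟩
        unfold IsReduced at *
        rw [List.isChain_append] at hcyc ⊢
        refine ⟨hl', h1, ?_⟩
        intro p hp q hq
        rw [List.head?_append_of_ne_nil _ hLne] at hq
        exact hcyc.2.2 p hp q hq
    obtain ⟨L', h1, h2⟩ := key (n - 1)
    rw [Nat.sub_add_cancel hn, hx'] at h2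
    have := h1.eq_nil (φ := φ) (g := 1) (h := 1) (by simp [h2])
    simp_all
  · -- otherwise a cyclic reduction shortens the word
    have hfail : ∃ b l₁, l₀ = (-u, b) :: l₁ ∧ a * g ∈ toSubgroup A B u := by
      unfold IsReduced at hcyc hl'
      rw [List.isChain_append] at hcyc
      have h1 : ¬ ∀ x ∈ (l₀ ++ [(u, a * g)]).getLast?, ∀ y ∈ (l₀ ++ [(u, a * g)]).head?,
          (x.2 ∈ toSubgroup A B x.1 → x.1 = y.1) := fun h => hcyc ⟨hl', hl', h⟩
      simp only [List.getLast?_append, List.getLast?_singleton, Option.some_or,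
        Option.mem_some_iff, forall_eq'] at h1
      cases l₀ with
      | nil => simp at h1
      | cons c l₁ =>
        simp only [List.cons_append, List.head?_cons, Option.mem_some_iff, forall_eq',
          Classical.not_imp] at h1
        refine ⟨c.2, l₁, ?_, h1.1⟩
        have : c.1 = -u := by
          rcases Int.units_eq_one_or u with rfl | rfl <;>
          rcases Int.units_eq_one_or c.1 with h | h <;> simp_all
        rw [← this]
    obtain ⟨b, l₁, rfl, hag⟩ := hfail
    have hred : IsReduced A B l₁ := by
      unfold IsReduced at *
      have := hl'.tail
      simp only [List.cons_append, List.tail_cons] at this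
      exact (List.isChain_append.1 this).1
    set c : G := (toSubgroupEquiv φ u ⟨a * g, hag⟩ : G) with hc
    have hcc := t_zpow_mul_of_mul (φ := φ) u ⟨a * g, hag⟩
    have e1 : wordProd φ ((-u, b) :: l₁ ++ [(u, a * g)]) =
        (t ^ (u : ℤ) * of (a * g))⁻¹ * (of (c * b) * wordProd φ l₁) *
          (t ^ (u : ℤ) * of (a * g)) := by
      rw [map_mul of c b, hc, ← hcc]
      simp [mul_assoc]
    have hlt : l₁.length < ((-u, b) :: l₁ ++ [(u, a)]).length := by simp
    obtain ⟨y, g', hy⟩ := ih l₁.length hlt (c * b) l₁ hred (by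
      rw [e1] at hx'
      have := conj_pow (a := (t ^ (u : ℤ) * of (a * g))⁻¹)
        (b := (of (c * b) * wordProd φ l₁ : HNNExtension G A B φ)) (i := n)
      rw [inv_inv] at this
      rw [this] at hx'
      have h3 := congrArg (fun z => (t ^ (u : ℤ) * of (a * g)) * z *
        (t ^ (u : ℤ) * of (a * g))⁻¹) hx'
      simpa [mul_assoc] using h3) rfl
    refine ⟨of g * (t ^ (u : ℤ) * of (a * g))⁻¹ * y, g', ?_⟩
    rw [hconj, e1, hy]
    simp [mul_assoc]

section Map

variable {K : Type*} [Group K] {C D : Subgroup K} {ψ : C ≃* D}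

/-- If a homomorphism of HNN extensions sends the base group into the base group, the stable
letter to the stable letter, and reflects membership in the associated subgroups, then only
elements of the base group can be sent to elements of the base group. -/
theorem exists_of_eq_of_map {j : K →* G} {F : HNNExtension K C D ψ →* HNNExtension G A B φ}
    (hF : ∀ k, F (of k) = of (j k)) (hFt : F t = t)
    (hC : ∀ k, j k ∈ A → k ∈ C) (hD : ∀ k, j k ∈ B → k ∈ D)
    {x : HNNExtension K C D ψ} {g : G} (hx : F x = of g) :
    ∃ k, x = of k ∧ of (j k) = (of g : HNNExtension G A B φ) := by
  obtain ⟨k, l, hl, rfl⟩ := exists_reduced x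
  have himg : ∀ l : List (ℤˣ × K), F (wordProd ψ l) =
      wordProd φ (l.map fun a => (a.1, j a.2)) := by
    intro l
    induction l with
    | nil => simp
    | cons a l ih => simp [ih, hF, hFt]
  rw [map_mul, hF, himg] at hx
  have hred : IsReduced A B (l.map fun a => (a.1, j a.2)) := by
    unfold IsReduced at *
    rw [List.isChain_map]
    refine hl.imp ?_
    intro a b hab h
    refine hab ?_
    revert h
    dsimp only
    rcases Int.units_eq_one_or a.1 with h | h <;> rw [h]
    · exact hC _
    · exact hD _
  have hnil := hred.eq_nil hx
  rw [List.map_eq_nil_iff] at hnil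
  subst hnil
  refine ⟨k, by simp, by simpa using hx⟩

end Map

end HNNExtension

/-- A group has no torsion if `1` is its only element of finite order. -/
def NoTorsion (G : Type*) [Group G] : Prop :=
  ∀ (g : G) (n : ℕ), 0 < n → g ^ n = 1 → g = 1

theorem NoTorsion.prod {G H : Type*} [Group G] [Group H] (hG : NoTorsion G) (hH : NoTorsion H) :
    NoTorsion (G × H) := fun _g n hn h =>
  Prod.ext (hG _ n hn (congrArg Prod.fst h)) (hH _ n hn (congrArg Prod.snd h))

theorem noTorsion_of_isMulTorsionFree (G : Type*) [Group G] [IsMulTorsionFree G] :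
    NoTorsion G := fun _g n hn h =>
  IsMulTorsionFree.pow_left_injective hn.ne' (by simpa using h)

theorem HNNExtension.noTorsion {G : Type*} [Group G] (hG : NoTorsion G) {A B : Subgroup G}
    (φ : A ≃* B) : NoTorsion (HNNExtension G A B φ) := by
  intro x n hn hx
  obtain ⟨y, g, rfl⟩ := exists_conj_of_pow_eq_one x hn hx
  rw [conj_pow, conj_eq_one_iff, ← map_pow, map_eq_one_iff _ (of_injective (φ := φ))] at hx
  rw [hG g n hn hx]
  simp

theorem Group.IsFinitelyPresented.fg (G : Type*) [Group G] [h : IsFinitelyPresented G] :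
    Group.FG G :=
  let ⟨_, _, hφ, _⟩ := h.out
  Group.fg_of_surjective hφ

open Monoid.Coprod in
/-- A group obtained from a finitely presented group by adjoining one generator and finitely many
relations is finitely presented. -/
theorem isFinitelyPresented_of_adjoin {G H : Type} [Group G] [Group H]
    [Group.IsFinitelyPresented G] (ι : G →* H) (s : H)
    {W : Set (Monoid.Coprod G (Multiplicative ℤ))}
    (hW : W.Finite) (hrel : ∀ w ∈ W, lift ι (zpowersHom H s) w = 1)
    (hgen : Subgroup.closure (Set.range ι ∪ {s}) = ⊤)
    (huniv : ∀ (Q : Type) [Group Q] (f : G →* Q) (q : Q),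
      (∀ w ∈ W, lift f (zpowersHom Q q) w = 1) → ∃ F : H →* Q, (∀ g, F (ι g) = f g) ∧ F s = q) :
    Group.IsFinitelyPresented H := by
  refine Group.IsFinitelyPresented.of_surjective (lift ι (zpowersHom H s)) ?_ ⟨W, hW, ?_⟩
  · rw [← MonoidHom.range_eq_top, eq_top_iff, ← hgen, Subgroup.closure_le]
    rintro _ (⟨g, rfl⟩ | rfl)
    · exact ⟨inl g, by simp⟩
    · exact ⟨inr (Multiplicative.ofAdd 1), by simp⟩
  · apply le_antisymm
    · exact Subgroup.normalClosure_le_normal fun w hw => hrel w hw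
    · obtain ⟨F, hF, hFs⟩ := huniv (Monoid.Coprod G (Multiplicative ℤ) ⧸ Subgroup.normalClosure W)
        ((QuotientGroup.mk' _).comp inl) (QuotientGroup.mk' _ (inr (Multiplicative.ofAdd 1))) (by
          intro w hw
          have : lift ((QuotientGroup.mk' (Subgroup.normalClosure W)).comp inl)
            (zpowersHom _ (QuotientGroup.mk' (Subgroup.normalClosure W)
              (inr (Multiplicative.ofAdd 1)))) = QuotientGroup.mk' (Subgroup.normalClosure W) := by
            apply hom_ext
            · ext; simp
            · ext; simp
          rw [this]
          exact (QuotientGroup.eq_one_iff _).2 (Subgroup.subset_normalClosure hw))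
      have key : F.comp (lift ι (zpowersHom H s)) =
          QuotientGroup.mk' (Subgroup.normalClosure W) := by
        apply hom_ext
        · ext g; simp [hF]
        · ext; simp [hFs]
      intro x hx
      rw [← QuotientGroup.eq_one_iff]
      change QuotientGroup.mk' (Subgroup.normalClosure W) x = 1
      rw [← key, MonoidHom.comp_apply, MonoidHom.mem_ker.1 hx, map_one]

theorem HNNExtension.closure_range_of_union_t {G : Type*} [Group G] {A B : Subgroup G}
    (φ : A ≃* B) :
    Subgroup.closure (Set.range (of : G →* HNNExtension G A B φ) ∪ {t}) = ⊤ := by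
  rw [eq_top_iff]
  rintro x -
  induction x using HNNExtension.induction_on with
  | of g => exact Subgroup.subset_closure (Or.inl ⟨g, rfl⟩)
  | t => exact Subgroup.subset_closure (Or.inr rfl)
  | mul x y hx hy => exact mul_mem hx hy
  | inv x hx => exact inv_mem hx

/-- The HNN extension identifying the ranges of two embeddings of a group. -/
abbrev HNNOf {P L : Type*} [Group P] [Group L] {f g : P →* L} (hf : Function.Injective f)
    (hg : Function.Injective g) : Type _ :=
  HNNExtension L f.range g.range ((MonoidHom.ofInjective hf).symm.trans (MonoidHom.ofInjective hg))

namespace HNNOf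

open HNNExtension

variable {P L : Type*} [Group P] [Group L] {f g : P →* L} (hf : Function.Injective f)
  (hg : Function.Injective g)

theorem t_mul (p : P) : (t : HNNOf hf hg) * of (f p) = of (g p) * t := by
  have := t_mul_of (φ := (MonoidHom.ofInjective hf).symm.trans (MonoidHom.ofInjective hg))
    (MonoidHom.ofInjective hf p)
  simpa [MonoidHom.ofInjective_apply] using this

theorem t_conj (p : P) : (t : HNNOf hf hg) * of (f p) * t⁻¹ = of (g p) := by
  rw [t_mul, mul_inv_cancel_right]

/-- The universal property of the HNN extension of two embeddings. -/
noncomputable def desc {Q : Type*} [Group Q] (F : L →* Q) (q : Q)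
    (h : ∀ p, q * F (f p) = F (g p) * q) :
    HNNOf hf hg →* Q :=
  lift F q (by
    intro a
    obtain ⟨p, rfl⟩ := (MonoidHom.ofInjective hf).surjective a
    simpa [MonoidHom.ofInjective_apply] using h p)

@[simp] theorem desc_of {Q : Type*} [Group Q] (F : L →* Q) (q : Q)
    (h : ∀ p, q * F (f p) = F (g p) * q) (x : L) : desc hf hg F q h (of x) = F x := by
  simp [desc]

@[simp] theorem desc_t {Q : Type*} [Group Q] (F : L →* Q) (q : Q)
    (h : ∀ p, q * F (f p) = F (g p) * q) : desc hf hg F q h t = q := by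
  simp [desc]

end HNNOf

theorem HNNOf.isFinitelyPresented {P L : Type} [Group P] [Group L] {f g : P →* L}
    (hf : Function.Injective f) (hg : Function.Injective g) [Group.FG P]
    [Group.IsFinitelyPresented L] : Group.IsFinitelyPresented (HNNOf hf hg) := by
  open HNNExtension Monoid.Coprod in
  obtain ⟨S, hS, hfin⟩ := (Group.fg_iff (G := P)).1 inferInstance
  let w : P → Monoid.Coprod L (Multiplicative ℤ) := fun p =>
    inr (Multiplicative.ofAdd 1) * inl (f p) * (inl (g p) * inr (Multiplicative.ofAdd 1))⁻¹
  have hw : ∀ (Q : Type) [Group Q] (F : L →* Q) (q : Q) (p : P),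
      lift F (zpowersHom Q q) (w p) = 1 ↔ q * F (f p) = F (g p) * q := by
    intro Q _ F q p
    simp only [w, map_mul, map_inv, lift_apply_inl, lift_apply_inr, zpowersHom_apply,
      toAdd_ofAdd, zpow_one]
    rw [mul_inv_eq_one]
  refine isFinitelyPresented_of_adjoin (of : L →* HNNOf hf hg) t (hfin.image w) ?_
    (closure_range_of_union_t _) ?_
  · rintro _ ⟨p, -, rfl⟩
    exact (hw _ _ _ _).2 (t_mul hf hg p)
  · intro Q _ F q h
    have hall : ∀ p, q * F (f p) = F (g p) * q := by
      have hc : ∀ p, p ∈ (F.comp g).eqLocus ((MulAut.conj q).toMonoidHom.comp (F.comp f)) ↔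
          q * F (f p) = F (g p) * q := by
        intro p
        change F (g p) = q * F (f p) * q⁻¹ ↔ _
        rw [eq_mul_inv_iff_mul_eq, eq_comm]
      have : Subgroup.closure S ≤
          (F.comp g).eqLocus ((MulAut.conj q).toMonoidHom.comp (F.comp f)) := by
        rw [Subgroup.closure_le]
        intro p hp
        exact (hc p).2 ((hw _ _ _ _).1 (h _ ⟨p, hp, rfl⟩))
      intro p
      exact (hc p).1 (this (hS ▸ Subgroup.mem_top p))
    exact ⟨desc hf hg F q hall, by simp, by simp⟩

/-- Given finitely many pairs of injective homomorphisms `α i`, `β i` to `K` pulling the subgroup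
`T` back to the same subgroup, adjoining stable letters conjugating `α i` to `β i` does not enlarge
the trace of `T` on `K`. -/
theorem exists_stable_letters {K : Type} [Group K] [Group.IsFinitelyPresented K]
    (hK : NoTorsion K) (T : Subgroup K) {I : Type*} {B : I → Type}
    [∀ i, Group (B i)] [∀ i, Group.FG (B i)] (α β : ∀ i, B i →* K)
    (hα : ∀ i, Function.Injective (α i))
    (hβ : ∀ i, Function.Injective (β i))
    (hT : ∀ i, T.comap (α i) = T.comap (β i)) (s : Finset I) :
    ∃ (L : Type) (_ : Group L) (ι : K →* L) (R : Set L), Group.IsFinitelyPresented L ∧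
      NoTorsion L ∧ Function.Injective ι ∧ R.Finite ∧
      (∀ i ∈ s, ∃ r ∈ R, ∀ k, r * ι (α i k) * r⁻¹ = ι (β i k)) ∧
      (Subgroup.closure (ι '' T ∪ R)).comap ι = T := by
  classical
  induction s using Finset.induction_on with
  | empty =>
    refine ⟨K, inferInstance, MonoidHom.id K, ∅, inferInstance, hK, fun _ _ h => h,
      Set.finite_empty, by simp, ?_⟩
    simp
  | insert i s hi ih =>
    open HNNExtension in
    obtain ⟨L, _, ι, R, hfp, htf, hinj, hR, hr, hcomap⟩ := ih
    have hf : Function.Injective (ι.comp (α i)) := hinj.comp (hα i)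
    have hg : Function.Injective (ι.comp (β i)) := hinj.comp (hβ i)
    set M := Subgroup.closure (ι '' T ∪ R) with hM
    have hmem : ∀ k, ι k ∈ M ↔ k ∈ T := fun k => by
      conv_rhs => rw [← hcomap]
      rfl
    have hTi : ∀ k, α i k ∈ T ↔ β i k ∈ T := fun k => by
      have := congrArg (k ∈ ·) (hT i)
      simpa using this
    let f' : T.comap (α i) →* M := ((ι.comp (α i)).comp (T.comap (α i)).subtype).codRestrict M
      fun k => (hmem _).2 k.2
    let g' : T.comap (α i) →* M := ((ι.comp (β i)).comp (T.comap (α i)).subtype).codRestrict M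
      fun k => (hmem _).2 ((hTi _).1 k.2)
    have hf' : Function.Injective f' := fun a b h => Subtype.ext (hf (congrArg Subtype.val h))
    have hg' : Function.Injective g' := fun a b h => Subtype.ext (hg (congrArg Subtype.val h))
    let F : HNNOf hf' hg' →* HNNOf hf hg := HNNOf.desc hf' hg' ((of).comp M.subtype) t
      (fun p => HNNOf.t_mul hf hg (p : B i))
    have hF : ∀ m : M, F (of m) = of (m : L) := fun m => HNNOf.desc_of _ _ _ _ _ _
    have hFt : F t = t := HNNOf.desc_t _ _ _ _ _
    refine ⟨HNNOf hf hg, inferInstance, (of).comp ι, of '' R ∪ {t},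
      HNNOf.isFinitelyPresented hf hg, noTorsion htf _, fun _ _ h => hinj (of_injective _ h),
      (hR.image _).union (Set.finite_singleton _), ?_, ?_⟩
    · intro j hj
      rcases Finset.mem_insert.1 hj with rfl | hj
      · exact ⟨t, Or.inr rfl, fun k => HNNOf.t_conj hf hg k⟩
      · obtain ⟨r, hrR, h⟩ := hr j hj
        refine ⟨of r, Or.inl ⟨r, hrR, rfl⟩, fun k => ?_⟩
        simp only [MonoidHom.comp_apply, ← h, map_mul, map_inv]
    · apply le_antisymm
      · intro k hk
        have hle : Subgroup.closure (((of : L →* HNNOf hf hg).comp ι) '' T ∪ (of '' R ∪ {t})) ≤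
            F.range := by
          rw [Subgroup.closure_le]
          rintro _ (⟨k, hk, rfl⟩ | ⟨r, hr, rfl⟩ | rfl)
          · exact ⟨of ⟨ι k, (hmem k).2 hk⟩, hF _⟩
          · exact ⟨of ⟨r, Subgroup.subset_closure (Or.inr hr)⟩, hF _⟩
          · exact ⟨t, hFt⟩
        obtain ⟨y, hy⟩ := hle hk
        obtain ⟨m, rfl, hm⟩ := exists_of_eq_of_map (j := M.subtype) hF hFt (by
            rintro ⟨m, hm⟩ ⟨k, rfl⟩
            exact ⟨⟨k, (hmem _).1 hm⟩, rfl⟩) (by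
            rintro ⟨m, hm⟩ ⟨k, rfl⟩
            exact ⟨⟨k, (hTi _).2 ((hmem _).1 hm)⟩, rfl⟩) hy
        have : (m : L) = ι k := of_injective _ hm
        exact (hmem k).1 (this ▸ m.2)
      · intro k hk
        exact Subgroup.subset_closure (Or.inl ⟨k, hk, rfl⟩)

theorem FreeGroup.comap_map_closure_image_of {X Y : Type*} {f : X → Y} (hf : Function.Injective f)
    (S : Set Y) : (Subgroup.closure (of '' S)).comap (map f) =
      Subgroup.closure (of '' (f ⁻¹' S)) := by
  classical
  apply le_antisymm
  · intro n hn
    let r : FreeGroup Y →* FreeGroup X :=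
      lift fun y => if h : ∃ x, f x = y then of h.choose else 1
    let q : FreeGroup Y →* FreeGroup Y := lift fun y => if y ∈ S then of y else 1
    have hr : ∀ x, r (of (f x)) = of x := fun x => by
      have h : ∃ x', f x' = f x := ⟨x, rfl⟩
      have h' : h.choose = x := hf h.choose_spec
      simp only [r, lift_apply_of]
      rw [dif_pos h, h']
    have hrf : r.comp (map f) = MonoidHom.id _ := by
      ext x
      simp [hr]
    have hq : Subgroup.closure (of '' S) ≤ q.eqLocus (MonoidHom.id _) := by
      rw [Subgroup.closure_le]
      rintro _ ⟨y, hy, rfl⟩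
      change q (of y) = of y
      simp [q, hy]
    have hrq : (r.comp (q.comp (map f))) n = n := by
      have h1 : q (map f n) = map f n := hq hn
      change r (q (map f n)) = n
      rw [h1]
      exact DFunLike.congr_fun hrf n
    rw [← hrq]
    have : (r.comp (q.comp (map f))).range ≤ Subgroup.closure (of '' (f ⁻¹' S)) := by
      have h2 : r.comp (q.comp (map f)) = lift fun x => if f x ∈ S then of x else 1 := by
        ext x
        by_cases h : f x ∈ S <;> simp [q, h, hr]
      rw [h2, range_lift_eq_closure, Subgroup.closure_le]
      rintro _ ⟨x, rfl⟩
      by_cases h : f x ∈ S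
      · simp only [h, if_true]
        exact Subgroup.subset_closure ⟨x, h, rfl⟩
      · simp only [h, if_false]
        exact one_mem _
    exact this ⟨n, rfl⟩
  · rw [Subgroup.closure_le]
    rintro _ ⟨x, hx, rfl⟩
    simp only [Subgroup.coe_comap, Set.mem_preimage, map.of]
    exact Subgroup.subset_closure ⟨_, hx, rfl⟩

/-- A group acting on the free group on its elements by left translation of the basis. -/
def translateAct (A : Type*) [Group A] : A →* MulAut (FreeGroup A) where
  toFun a := FreeGroup.freeGroupCongr (Equiv.mulLeft a)
  map_one' := by
    ext x
    simp
  map_mul' a b := by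
    apply MulEquiv.toMonoidHom_injective
    ext x
    simp [mul_assoc]

@[simp] theorem translateAct_of {A : Type*} [Group A] (a b : A) :
    translateAct A a (FreeGroup.of b) = FreeGroup.of (a * b) := by
  simp [translateAct]

/-- The free product of `A` and an infinite cyclic group generated by `t`, seen as the semidirect
product of `A` with the free group on the conjugates of `t`. -/
abbrev FreeStable (A : Type*) [Group A] : Type _ := FreeGroup A ⋊[translateAct A] A

namespace FreeStable

open SemidirectProduct

variable {A B : Type*} [Group A] [Group B]

/-- The conjugate of the free generator by `a`. -/
def conjT (a : A) : FreeStable A := inl (FreeGroup.of a)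

theorem inr_mul_conjT (a b : A) : inr a * conjT b * (inr a)⁻¹ = (conjT (a * b) : FreeStable A) := by
  rw [conjT, conjT, ← translateAct_of, inl_aut]
  simp

/-- The homomorphism out of the free product determined by its values. -/
def desc {Q : Type*} [Group Q] (f : A →* Q) (q : Q) : FreeStable A →* Q :=
  SemidirectProduct.lift (FreeGroup.lift fun a => f a * q * (f a)⁻¹) f (by
    intro a
    ext b
    simp [mul_assoc])

@[simp] theorem desc_inr {Q : Type*} [Group Q] (f : A →* Q) (q : Q) (a : A) :
    desc f q (inr a) = f a := by simp [desc]

@[simp] theorem desc_conjT {Q : Type*} [Group Q] (f : A →* Q) (q : Q) (a : A) :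
    desc f q (conjT a) = f a * q * (f a)⁻¹ := by simp [desc, conjT]

theorem closure_range_inr_union (A : Type*) [Group A] :
    Subgroup.closure (Set.range (inr : A →* FreeStable A) ∪ {conjT 1}) = ⊤ := by
  rw [eq_top_iff]
  rintro ⟨n, a⟩ -
  rw [← inl_left_mul_inr_right (⟨n, a⟩ : FreeStable A)]
  refine mul_mem ?_ (Subgroup.subset_closure (Or.inl ⟨a, rfl⟩))
  change n ∈ (Subgroup.closure (Set.range (inr : A →* FreeStable A) ∪ {conjT 1})).comap inl
  have : (⊤ : Subgroup (FreeGroup A)) ≤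
      (Subgroup.closure (Set.range (inr : A →* FreeStable A) ∪ {conjT 1})).comap inl := by
    rw [← FreeGroup.closure_range_of, Subgroup.closure_le]
    rintro _ ⟨b, rfl⟩
    have h := inr_mul_conjT b (1 : A)
    rw [mul_one] at h
    change conjT b ∈ Subgroup.closure (Set.range (inr : A →* FreeStable A) ∪ {conjT 1})
    rw [← h]
    exact mul_mem (mul_mem (Subgroup.subset_closure (Or.inl ⟨b, rfl⟩))
      (Subgroup.subset_closure (Or.inr rfl))) (inv_mem (Subgroup.subset_closure (Or.inl ⟨b, rfl⟩)))
  exact this (Subgroup.mem_top n)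

instance isFinitelyPresented {A : Type} [Group A] [Group.IsFinitelyPresented A] :
    Group.IsFinitelyPresented (FreeStable A) :=
  isFinitelyPresented_of_adjoin inr (conjT 1) Set.finite_empty (by simp)
    (closure_range_inr_union A) fun Q _ f q _ => ⟨desc f q, by simp, by simp⟩

instance fg [Group.FG A] : Group.FG (FreeStable A) := by
  obtain ⟨S, hS, hfin⟩ := (Group.fg_iff (G := A)).1 inferInstance
  refine Group.fg_iff.2 ⟨inr '' S ∪ {conjT 1}, ?_,
    (hfin.image _).union (Set.finite_singleton _)⟩
  rw [Subgroup.closure_union, ← MonoidHom.map_closure, hS, ← MonoidHom.range_eq_map,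
    ← closure_range_inr_union, Subgroup.closure_union, ← MonoidHom.coe_range, Subgroup.closure_eq]

theorem noTorsion (hA : NoTorsion A) : NoTorsion (FreeStable A) := by
  intro x n hn hx
  have h1 : x.right = 1 := hA _ n hn (by
    have := congrArg (SemidirectProduct.rightHom (φ := translateAct A)) hx
    rw [map_pow, map_one] at this
    exact this)
  have h2 : x = inl x.left := by
    conv_lhs => rw [← inl_left_mul_inr_right x, h1, map_one, mul_one]
  rw [h2] at hx ⊢
  rw [← map_pow, map_eq_one_iff _ inl_injective] at hx
  rw [noTorsion_of_isMulTorsionFree _ _ n hn hx, map_one]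

/-- The homomorphism sending `a` to `α a` and `t` to its conjugate by `g`. -/
def mapShift (α : A →* B) (g : B) : FreeStable A →* FreeStable B :=
  SemidirectProduct.map (FreeGroup.map fun a => α a * g) α (by
    intro a
    ext b
    simp [mul_assoc])

@[simp] theorem mapShift_conjT (α : A →* B) (g : B) (a : A) :
    mapShift α g (conjT a) = conjT (α a * g) := by
  simp [mapShift, conjT]

theorem mapShift_injective {α : A →* B} (hα : Function.Injective α) (g : B) :
    Function.Injective (mapShift α g) := by
  rw [injective_iff_map_eq_one]
  intro x hx
  have h1 := congrArg SemidirectProduct.left hx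
  have h2 := congrArg SemidirectProduct.right hx
  have hf : Function.Injective fun a => α a * g := fun a b h => hα (mul_right_cancel h)
  simp only [mapShift, map_left, map_right, one_left, one_right] at h1 h2
  ext1
  · exact (map_eq_one_iff _ (FreeGroup.map_injective hf)).1 h1
  · exact (map_eq_one_iff _ hα).1 h2

/-- The subgroup freely generated by the conjugates of `t` by elements of `S`. -/
def traceSubgroup (S : Set A) : Subgroup (FreeStable A) :=
  (Subgroup.closure (FreeGroup.of '' S)).map inl

theorem traceSubgroup_eq (S : Set A) : traceSubgroup S = Subgroup.closure (conjT '' S) := by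
  rw [traceSubgroup, MonoidHom.map_closure, Set.image_image]
  rfl

theorem mem_traceSubgroup {S : Set A} {x : FreeStable A} :
    x ∈ traceSubgroup S ↔ x.right = 1 ∧ x.left ∈ Subgroup.closure (FreeGroup.of '' S) := by
  constructor
  · rintro ⟨n, hn, rfl⟩
    exact ⟨by simp, by simpa using hn⟩
  · rintro ⟨h1, h2⟩
    refine ⟨x.left, h2, ?_⟩
    conv_rhs => rw [← inl_left_mul_inr_right x, h1, map_one, mul_one]

theorem comap_mapShift {α : A →* B} (hα : Function.Injective α) (g : B) (S : Set B) :
    (traceSubgroup S).comap (mapShift α g) = traceSubgroup ((fun a => α a * g) ⁻¹' S) := by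
  have hf : Function.Injective fun a => α a * g := fun a b h => hα (mul_right_cancel h)
  ext x
  rw [Subgroup.mem_comap, mem_traceSubgroup, mem_traceSubgroup,
    ← FreeGroup.comap_map_closure_image_of hf]
  simp only [mapShift, map_left, map_right, map_eq_one_iff _ hα]
  rfl

end FreeStable

/-- A set `E` in a group `F` is benign if the trace subgroup of `E` in the free product of `F` with
an infinite cyclic group is cut out by a finitely generated subgroup of a finitely presented
torsion-free overgroup. -/
def IsBenign {F : Type} [Group F] (E : Set F) : Prop :=
  ∃ (L : Type) (_ : Group L) (ι : FreeStable F →* L) (M : Subgroup L),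
    Group.IsFinitelyPresented L ∧ NoTorsion L ∧ Function.Injective ι ∧ M.FG ∧
      M.comap ι = FreeStable.traceSubgroup E

theorem IsBenign.preimage {F A : Type} [Group F] [Group A] {S : Set A} (hS : IsBenign S)
    {γ : F →* A} (hγ : Function.Injective γ) : IsBenign (γ ⁻¹' S) := by
  obtain ⟨L, _, ι, M, hfp, htf, hι, hM, h⟩ := hS
  refine ⟨L, inferInstance, ι.comp (FreeStable.mapShift γ 1), M, hfp, htf,
    hι.comp (FreeStable.mapShift_injective hγ 1), hM, ?_⟩
  rw [← Subgroup.comap_comap, h, FreeStable.comap_mapShift hγ]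
  simp

/-- One step of a system of affine rewriting rules on a group. -/
def AffineStep {A I : Type*} [Group A] {B : I → Type*} [∀ i, Group (B i)]
    (α β : ∀ i, B i →* A) (g h : I → A) (x y : A) : Prop :=
  ∃ i a, x = α i a * g i ∧ y = β i a * h i

/-- The orbit of a point under finitely many injective affine rewriting rules is benign. -/
theorem isBenign_orbit {A I : Type} [Group A] [Group.IsFinitelyPresented A] (hA : NoTorsion A)
    [Finite I] {B : I → Type} [∀ i, Group (B i)] [∀ i, Group.FG (B i)] (α β : ∀ i, B i →* A)
    (g h : I → A) (hα : ∀ i, Function.Injective (α i))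
    (hβ : ∀ i, Function.Injective (β i)) (b : A) :
    IsBenign {x | Relation.EqvGen (AffineStep α β g h) b x} := by
  classical
  have := Fintype.ofFinite I
  set S : Set A := {x | Relation.EqvGen (AffineStep α β g h) b x} with hS
  have hiff : ∀ i a, α i a * g i ∈ S ↔ β i a * h i ∈ S := fun i a => by
    have : Relation.EqvGen (AffineStep α β g h) _ _ := .rel _ _ ⟨i, a, rfl, rfl⟩
    exact ⟨fun hx => .trans _ _ _ hx this, fun hx => .trans _ _ _ hx (.symm _ _ this)⟩
  obtain ⟨L, _, ι, R, hfp, htf, hι, hR, hr, hT⟩ := exists_stable_letters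
    (FreeStable.noTorsion hA) (FreeStable.traceSubgroup S)
    (fun i => FreeStable.mapShift (α i) (g i)) (fun i => FreeStable.mapShift (β i) (h i))
    (fun i => FreeStable.mapShift_injective (hα i) _)
    (fun i => FreeStable.mapShift_injective (hβ i) _)
    (fun i => by
      rw [FreeStable.comap_mapShift (hα i), FreeStable.comap_mapShift (hβ i)]
      congr 1
      ext a
      exact hiff i a) Finset.univ
  set M := Subgroup.closure (ι '' (FreeStable.traceSubgroup S : Set (FreeStable A)) ∪ R) with hM
  refine ⟨L, inferInstance, ι, M, hfp, htf, hι, ?_, hT⟩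
  refine (Subgroup.fg_iff M).2 ⟨{ι (FreeStable.conjT b)} ∪ R, ?_,
    (Set.finite_singleton _).union hR⟩
  set N := Subgroup.closure ({ι (FreeStable.conjT b)} ∪ R) with hN
  have hRN : R ⊆ N := fun r hr => Subgroup.subset_closure (Or.inr hr)
  apply le_antisymm
  · rw [hN, Subgroup.closure_le]
    rintro _ (rfl | hr)
    · refine Subgroup.subset_closure (Or.inl ⟨_, ?_, rfl⟩)
      rw [FreeStable.traceSubgroup_eq]
      exact Subgroup.subset_closure ⟨b, .refl _, rfl⟩
    · exact Subgroup.subset_closure (Or.inr hr)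
  · rw [hM, Subgroup.closure_le]
    rintro _ (⟨x, hx, rfl⟩ | hr)
    · have hstep : ∀ x y, Relation.EqvGen (AffineStep α β g h) x y →
          (ι (FreeStable.conjT x) ∈ N ↔ ι (FreeStable.conjT y) ∈ N) := by
        intro x y hxy
        induction hxy with
        | rel x y hxy =>
          obtain ⟨i, a, rfl, rfl⟩ := hxy
          obtain ⟨r, hrR, hr⟩ := hr i (Finset.mem_univ i)
          have := hr (FreeStable.conjT a)
          rw [FreeStable.mapShift_conjT, FreeStable.mapShift_conjT] at this
          rw [← this, Subgroup.mul_mem_cancel_right _ (inv_mem (hRN hrR)),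
            Subgroup.mul_mem_cancel_left _ (hRN hrR)]
        | refl => rfl
        | symm _ _ _ ih => exact ih.symm
        | trans _ _ _ _ _ ih₁ ih₂ => exact ih₁.trans ih₂
      rw [FreeStable.traceSubgroup_eq] at hx
      have hle : Subgroup.closure (FreeStable.conjT '' S) ≤ N.comap ι := by
        rw [Subgroup.closure_le]
        rintro _ ⟨y, hy, rfl⟩
        exact (hstep _ _ hy).1 (Subgroup.subset_closure (Or.inl rfl))
      exact hle hx
    · exact Subgroup.subset_closure (Or.inr hr)

section Rope

variable {L C P : Type} [Group L] [Group C] [Group P] {j : P →* L}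

theorem inl_comp_injective (hj : Function.Injective j) :
    Function.Injective ((MonoidHom.inl L C).comp j) :=
  fun _ _ h => hj (congrArg Prod.fst h)

theorem prod_injective_left (hj : Function.Injective j) (φ : P →* C) :
    Function.Injective (j.prod φ) :=
  fun _ _ h => hj (congrArg Prod.fst h)

variable (hj : Function.Injective j) (φ : P →* C)

/-- The extension of `L × C` by a stable letter conjugating each `p` in a subgroup `P` of `L` to
`(p, φ p)`. -/
abbrev Rope : Type :=
  HNNOf (inl_comp_injective (C := C) hj) (prod_injective_left hj φ)

namespace Rope

open HNNExtension

/-- The embedding of the first factor. -/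
noncomputable def left : L →* Rope hj φ := (of).comp (MonoidHom.inl L C)

/-- The embedding of the second factor. -/
noncomputable def right : C →* Rope hj φ := (of).comp (MonoidHom.inr L C)

theorem right_injective : Function.Injective (right hj φ) := fun _ _ h =>
  congrArg Prod.snd (of_injective _ h)

theorem of_mk (l : L) (c : C) : (of (l, c) : Rope hj φ) = left hj φ l * right hj φ c := by
  simp [left, right, ← map_mul]

theorem commute_left_right (l : L) (c : C) : Commute (left hj φ l) (right hj φ c) := by
  simp [left, right, commute_iff_eq, ← map_mul]

theorem t_conj_left (p : P) :
    (t : Rope hj φ) * left hj φ (j p) * t⁻¹ = left hj φ (j p) * right hj φ (φ p) := by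
  rw [← of_mk]
  exact HNNOf.t_conj (inl_comp_injective (C := C) hj) (prod_injective_left hj φ) p

theorem closure_range_left_union_t (hφ : Function.Surjective φ) :
    Subgroup.closure (Set.range (left hj φ) ∪ {t}) = ⊤ := by
  rw [eq_top_iff, ← closure_range_of_union_t, Subgroup.closure_le]
  have hl : ∀ l, left hj φ l ∈ Subgroup.closure (Set.range (left hj φ) ∪ {t}) := fun l =>
    Subgroup.subset_closure (Or.inl ⟨l, rfl⟩)
  have ht : (t : Rope hj φ) ∈ Subgroup.closure (Set.range (left hj φ) ∪ {t}) :=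
    Subgroup.subset_closure (Or.inr rfl)
  rintro _ (⟨⟨l, c⟩, rfl⟩ | rfl)
  · rw [of_mk hj φ]
    refine mul_mem (hl l) ?_
    obtain ⟨p, rfl⟩ := hφ c
    have : right hj φ (φ p) = (left hj φ (j p))⁻¹ * (t * left hj φ (j p) * t⁻¹) := by
      rw [t_conj_left, inv_mul_cancel_left]
    rw [this]
    exact mul_mem (inv_mem (hl _)) (mul_mem (mul_mem ht (hl _)) (inv_mem ht))
  · exact ht

theorem noTorsion (hL : NoTorsion L) (hC : NoTorsion C) : NoTorsion (Rope hj φ) :=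
  HNNExtension.noTorsion (hL.prod hC) _

/-- The commutator-like map `p ↦ p⁻¹ q p q⁻¹` is a homomorphism as soon as its values on generators
centralise the group. -/
theorem exists_delta {Q : Type} [Group Q] (f : L →* Q) (q : Q) {S : Set P}
    (hS : Subgroup.closure S = ⊤)
    (h : ∀ p ∈ S, ∀ l, Commute ((f (j p))⁻¹ * q * f (j p) * q⁻¹) (f l)) :
    ∃ δ : P →* Q, (∀ p, δ p = (f (j p))⁻¹ * q * f (j p) * q⁻¹) ∧ ∀ p l, Commute (δ p) (f l) := by
  let d : P → Q := fun p => (f (j p))⁻¹ * q * f (j p) * q⁻¹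
  have hmul : ∀ p p', (∀ l, Commute (d p) (f l)) → d (p * p') = d p * d p' := by
    intro p p' hp
    have h1 : d p = (f (j p'))⁻¹ * d p * f (j p') := by
      rw [mul_assoc, (hp _).eq, inv_mul_cancel_left]
    rw [h1]
    simp only [d, map_mul]
    group
  have hd1 : d 1 = 1 := by simp [d]
  have hall : ∀ p l, Commute (d p) (f l) := by
    intro p
    have hp : p ∈ Subgroup.closure S := hS ▸ Subgroup.mem_top p
    induction hp using Subgroup.closure_induction with
    | mem p hp => exact h p hp
    | one => intro l; rw [hd1]; exact Commute.one_left _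
    | mul x y _ _ hx hy => intro l; rw [hmul x y hx]; exact (hx l).mul_left (hy l)
    | inv x _ hx =>
      intro l
      have := hmul x x⁻¹ hx
      rw [mul_inv_cancel, hd1] at this
      rw [eq_inv_of_mul_eq_one_right this.symm]
      exact (hx l).inv_left
  exact ⟨MonoidHom.mk' d fun a b => hmul a b (hall a), fun _ => rfl, hall⟩

open Monoid.Coprod in
theorem isFinitelyPresented [Group.IsFinitelyPresented L] [Group.FG P]
    (hφ : Function.Surjective φ) {Z : Set P} (hZ : Z.Finite)
    (hker : φ.ker = Subgroup.normalClosure Z) : Group.IsFinitelyPresented (Rope hj φ) := by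
  have := Group.IsFinitelyPresented.fg L
  obtain ⟨S, hS, hSfin⟩ := (Group.fg_iff (G := P)).1 inferInstance
  obtain ⟨U, hU, hUfin⟩ := (Group.fg_iff (G := L)).1 inferInstance
  let τ : Monoid.Coprod L (Multiplicative ℤ) := inr (Multiplicative.ofAdd 1)
  let w : P × L → Monoid.Coprod L (Multiplicative ℤ) := fun x =>
    (inl (j x.1))⁻¹ * τ * inl (j x.1) * τ⁻¹ * inl x.2 *
      (inl x.2 * ((inl (j x.1))⁻¹ * τ * inl (j x.1) * τ⁻¹))⁻¹
  let v : P → Monoid.Coprod L (Multiplicative ℤ) := fun z => τ * inl (j z) * (inl (j z) * τ)⁻¹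
  have hw : ∀ (Q : Type) [Group Q] (f : L →* Q) (q : Q) (x : P × L),
      lift f (zpowersHom Q q) (w x) = 1 ↔
        Commute ((f (j x.1))⁻¹ * q * f (j x.1) * q⁻¹) (f x.2) := by
    intro Q _ f q x
    simp only [w, τ, map_mul, map_inv, lift_apply_inl, lift_apply_inr,
      zpowersHom_apply, toAdd_ofAdd, zpow_one]
    rw [mul_inv_eq_one, commute_iff_eq]
  have hv : ∀ (Q : Type) [Group Q] (f : L →* Q) (q : Q) (z : P),
      lift f (zpowersHom Q q) (v z) = 1 ↔ Commute q (f (j z)) := by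
    intro Q _ f q z
    simp only [v, τ, map_mul, map_inv, lift_apply_inl, lift_apply_inr,
      zpowersHom_apply, toAdd_ofAdd, zpow_one]
    rw [mul_inv_eq_one, commute_iff_eq]
  refine isFinitelyPresented_of_adjoin (left hj φ) t
    (W := w '' (S ×ˢ U) ∪ v '' Z) (((hSfin.prod hUfin).image w).union (hZ.image v)) ?_
    (closure_range_left_union_t hj φ hφ) ?_
  · rintro _ (⟨⟨p, l⟩, -, rfl⟩ | ⟨z, hz, rfl⟩)
    · rw [hw]
      have : (left hj φ (j p))⁻¹ * t * left hj φ (j p) * t⁻¹ = right hj φ (φ p) := by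
        rw [mul_assoc, mul_assoc, ← mul_assoc t, t_conj_left, inv_mul_cancel_left]
      rw [this]
      exact (commute_left_right hj φ l (φ p)).symm
    · rw [hv]
      have h1 := t_conj_left hj φ z
      have h2 : φ z = 1 := by
        rw [← MonoidHom.mem_ker, hker]
        exact Subgroup.subset_normalClosure hz
      rw [h2, map_one, mul_one, mul_inv_eq_iff_eq_mul] at h1
      exact h1
  · intro Q _ f q h
    obtain ⟨δ, hδ, hc⟩ := exists_delta (j := j) f q hS (by
      intro p hp l
      have hl : l ∈ Subgroup.closure U := hU ▸ Subgroup.mem_top l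
      induction hl using Subgroup.closure_induction with
      | mem l hl => exact (hw _ _ _ (p, l)).1 (h _ (Or.inl ⟨(p, l), ⟨hp, hl⟩, rfl⟩))
      | one => rw [map_one]; exact Commute.one_right _
      | mul x y _ _ hx hy => rw [map_mul]; exact hx.mul_right hy
      | inv x _ hx => rw [map_inv]; exact hx.inv_right)
    have hδker : φ.ker ≤ δ.ker := by
      rw [hker]
      refine Subgroup.normalClosure_le_normal fun z hz => ?_
      have := (hv _ _ _ z).1 (h _ (Or.inr ⟨z, hz, rfl⟩))
      change δ z = 1
      rw [hδ, mul_assoc _ q, this.eq, inv_mul_cancel_left, mul_inv_cancel]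
    let δ' : C →* Q := φ.liftOfSurjective hφ ⟨δ, hδker⟩
    have hδ' : ∀ p, δ' (φ p) = δ p := fun p => φ.liftOfRightInverse_comp_apply _ _ ⟨δ, hδker⟩ p
    have hcomm : ∀ l c, Commute (f l) (δ' c) := fun l c => by
      obtain ⟨p, rfl⟩ := hφ c
      rw [hδ']
      exact (hc p l).symm
    refine ⟨HNNOf.desc _ _ (MonoidHom.noncommCoprod f δ' hcomm) q fun p => ?_, fun l => ?_, ?_⟩
    · simp only [MonoidHom.comp_apply, MonoidHom.inl_apply, MonoidHom.noncommCoprod_apply,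
        map_one, mul_one, MonoidHom.prod_apply, hδ', hδ]
      group
    · simp [left]
    · simp
  
end Rope

end Rope

section Tor

variable {G H : Type*} [Group G] [Group H]

instance tor_normal (G : Type*) [Group G] (n : ℕ) : (tor G n).Normal := by
  cases n with
  | zero => unfold tor; infer_instance
  | succ n => unfold tor; infer_instance

theorem tor_le_succ (G : Type*) [Group G] (n : ℕ) : tor G n ≤ tor G (n + 1) := fun g hg =>
  Subgroup.subset_normalClosure ⟨1, one_pos, by simpa using hg⟩

theorem tor_le_comap (f : G →* H) (n : ℕ) : tor G n ≤ (tor H n).comap f := by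
  induction n with
  | zero => simp [tor]
  | succ n ih =>
    refine Subgroup.normalClosure_le_normal ?_
    rintro g ⟨k, hk, h⟩
    exact Subgroup.subset_normalClosure ⟨k, hk, by simpa using ih h⟩

theorem comap_tor (e : G ≃* H) (n : ℕ) : (tor H n).comap (e : G →* H) = tor G n := by
  refine le_antisymm (fun g hg => ?_) (tor_le_comap _ n)
  have := tor_le_comap (e.symm : H →* G) n hg
  simpa using this

theorem tor_eq_succ_iff_of_mulEquiv (e : G ≃* H) (n : ℕ) :
    tor G n = tor G (n + 1) ↔ tor H n = tor H (n + 1) := by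
  rw [← comap_tor e, ← comap_tor e]
  exact (Subgroup.comap_injective e.surjective).eq_iff

end Tor

namespace Rope

open HNNExtension

variable {L C P : Type} [Group L] [Group C] [Group P] {j : P →* L} (hj : Function.Injective j)
  (φ : P →* C) (T : Subgroup C) [T.Normal]

/-- The map of extensions induced by a quotient map of the second factor. -/
noncomputable def toQuotient : Rope hj φ →* Rope hj ((QuotientGroup.mk' T).comp φ) :=
  HNNOf.desc _ _ ((of).comp ((MonoidHom.id L).prodMap (QuotientGroup.mk' T))) t (by
    intro p
    simpa using HNNOf.t_mul (inl_comp_injective hj)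
      (prod_injective_left hj ((QuotientGroup.mk' T).comp φ)) p)

@[simp] theorem toQuotient_left (l : L) : toQuotient hj φ T (left hj φ l) = left hj _ l := by
  simp [toQuotient, left]

@[simp] theorem toQuotient_right (c : C) :
    toQuotient hj φ T (right hj φ c) = right hj _ (QuotientGroup.mk' T c) := by
  simp [toQuotient, right]

@[simp] theorem toQuotient_t : toQuotient hj φ T t = t := by
  simp [toQuotient]

theorem toQuotient_surjective : Function.Surjective (toQuotient hj φ T) := by
  intro x
  change x ∈ (toQuotient hj φ T).range
  induction x using HNNExtension.induction_on with
  | of g =>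
    obtain ⟨l, c⟩ := g
    obtain ⟨c, rfl⟩ := QuotientGroup.mk'_surjective T c
    exact ⟨left hj φ l * right hj φ c, by rw [of_mk hj, map_mul]; simp⟩
  | t => exact ⟨t, by simp⟩
  | mul x y hx hy => exact mul_mem hx hy
  | inv x hx => exact inv_mem hx

theorem ker_toQuotient : (toQuotient hj φ T).ker = Subgroup.normalClosure (right hj φ '' T) := by
  apply le_antisymm
  · set N := Subgroup.normalClosure (right hj φ '' (T : Set C)) with hN
    let ψ : C ⧸ T →* Rope hj φ ⧸ N := QuotientGroup.lift T ((QuotientGroup.mk' N).comp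
      (right hj φ)) fun c hc => (QuotientGroup.eq_one_iff _).2
        (Subgroup.subset_normalClosure ⟨c, hc, rfl⟩)
    have hψ : ∀ c, ψ (QuotientGroup.mk' T c) = QuotientGroup.mk' N (right hj φ c) := fun _ => rfl
    have hcomm : ∀ l c, Commute (((QuotientGroup.mk' N).comp (left hj φ)) l) (ψ c) := by
      intro l c
      obtain ⟨c, rfl⟩ := QuotientGroup.mk'_surjective T c
      rw [hψ]
      exact (commute_left_right hj φ l c).map (QuotientGroup.mk' N)
    let Ψ : Rope hj ((QuotientGroup.mk' T).comp φ) →* Rope hj φ ⧸ N :=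
      HNNOf.desc _ _ (MonoidHom.noncommCoprod ((QuotientGroup.mk' N).comp (left hj φ)) ψ hcomm)
        (QuotientGroup.mk' N t) (by
          intro p
          simp only [MonoidHom.comp_apply, MonoidHom.inl_apply, MonoidHom.noncommCoprod_apply,
            map_one, mul_one, MonoidHom.prod_apply, hψ, ← map_mul]
          rw [← t_conj_left, inv_mul_cancel_right])
    have key : Ψ.comp (toQuotient hj φ T) = QuotientGroup.mk' N := by
      apply HNNExtension.hom_ext
      · refine MonoidHom.ext fun ⟨l, c⟩ => ?_
        simp only [MonoidHom.comp_apply]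
        rw [of_mk hj φ, map_mul, map_mul, toQuotient_left, toQuotient_right, map_mul]
        have h1 : (of (1, 1) : Rope hj φ) ∈ N :=
          (map_one (of : L × C →* Rope hj φ)).symm ▸ one_mem N
        simpa [Ψ, left, right, ψ] using h1
      · simp [Ψ]
    intro x hx
    rw [← QuotientGroup.eq_one_iff]
    change QuotientGroup.mk' N x = 1
    rw [← key, MonoidHom.comp_apply, MonoidHom.mem_ker.1 hx, map_one]
  · refine Subgroup.normalClosure_le_normal ?_
    rintro _ ⟨c, hc, rfl⟩
    rw [SetLike.mem_coe, MonoidHom.mem_ker, toQuotient_right, QuotientGroup.mk'_apply,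
      (QuotientGroup.eq_one_iff c).2 hc, map_one]

theorem comap_normalClosure :
    (Subgroup.normalClosure (right hj φ '' T)).comap (right hj φ) = T := by
  rw [← ker_toQuotient]
  ext c
  rw [Subgroup.mem_comap, MonoidHom.mem_ker, toQuotient_right,
    map_eq_one_iff _ (right_injective hj _), QuotientGroup.mk'_apply, QuotientGroup.eq_one_iff]

theorem tor_eq (hL : NoTorsion L) (n : ℕ) :
    tor (Rope hj φ) n = Subgroup.normalClosure (right hj φ '' tor C n) := by
  induction n with
  | zero =>
    symm
    simp [tor]
  | succ n ih =>
    apply le_antisymm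
    · refine Subgroup.normalClosure_le_normal ?_
      rintro x ⟨k, hk, hx⟩
      rw [ih, ← ker_toQuotient, MonoidHom.mem_ker, map_pow] at hx
      obtain ⟨y, ⟨l, c⟩, hxy⟩ := exists_conj_of_pow_eq_one _ hk hx
      have hlc : (l, c) ^ k = 1 := by
        rw [hxy, conj_pow, conj_eq_one_iff, ← map_pow, map_eq_one_iff _ (of_injective _)] at hx
        exact hx
      obtain rfl : l = 1 := hL l k hk (congrArg Prod.fst hlc)
      obtain ⟨y, rfl⟩ := toQuotient_surjective hj φ _ y
      obtain ⟨c, rfl⟩ := QuotientGroup.mk'_surjective _ c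
      have hc : c ^ k ∈ tor C n := (QuotientGroup.eq_one_iff _).1 (congrArg Prod.snd hlc)
      have hc' : c ∈ tor C (n + 1) := Subgroup.subset_normalClosure ⟨k, hk, hc⟩
      have h1 : x * (y * right hj φ c * y⁻¹)⁻¹ ∈ (toQuotient hj φ (tor C n)).ker := by
        rw [MonoidHom.mem_ker, map_mul, hxy, of_mk hj]
        simp
      rw [ker_toQuotient] at h1
      have h2 : y * right hj φ c * y⁻¹ ∈ Subgroup.normalClosure (right hj φ '' tor C (n + 1)) :=
        Subgroup.normalClosure_normal.conj_mem _
          (Subgroup.subset_normalClosure (Set.mem_image_of_mem _ hc')) y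
      have h3 := Subgroup.normalClosure_mono (Set.image_mono (tor_le_succ C n)) h1
      rw [SetLike.mem_coe]
      exact (Subgroup.mul_mem_cancel_right _ (inv_mem h2)).1 h3
    · refine Subgroup.normalClosure_le_normal ?_
      rintro _ ⟨c, hc, rfl⟩
      exact tor_le_comap (right hj φ) (n + 1) hc

theorem tor_eq_succ_iff (hL : NoTorsion L) (n : ℕ) :
    tor C n = tor C (n + 1) ↔ tor (Rope hj φ) n = tor (Rope hj φ) (n + 1) := by
  rw [tor_eq hj φ hL, tor_eq hj φ hL]
  refine ⟨fun h => by rw [h], fun h => ?_⟩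
  rw [← comap_normalClosure hj φ (tor C n), h, comap_normalClosure]

end Rope

/-- The HNN extension by a stable letter centralising the subgroup `E`. -/
abbrev CentralizingExtension {F : Type*} [Group F] (E : Subgroup F) : Type _ :=
  HNNOf (P := E) (f := E.subtype) (g := E.subtype) E.subtype_injective E.subtype_injective

namespace CentralizingExtension

open HNNExtension

variable {F : Type} [Group F] (E : Subgroup F)

theorem commute_t {e : F} (he : e ∈ E) : Commute (t : CentralizingExtension E) (of e) :=
  HNNOf.t_mul E.subtype_injective E.subtype_injective ⟨e, he⟩

/-- The conjugate embedding of the base group. -/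
noncomputable def conjOf : F →* CentralizingExtension E := (MulAut.conj t).toMonoidHom.comp of

theorem conjOf_apply (x : F) : conjOf E x = t * of x * t⁻¹ := rfl

/-- The subgroup generated by the base group and its conjugate by the stable letter. -/
noncomputable def double : Subgroup (CentralizingExtension E) := (of).range ⊔ (conjOf E).range

/-- The first embedding of the base group. -/
noncomputable def double₁ : F →* double E := (of).codRestrict _ fun x =>
  (le_sup_left : _ ≤ double E) ⟨x, rfl⟩

/-- The second embedding of the base group. -/
noncomputable def double₂ : F →* double E := (conjOf E).codRestrict _ fun x =>
  (le_sup_right : _ ≤ double E) ⟨x, rfl⟩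

theorem double₁_eq_double₂ {e : F} (he : e ∈ E) : double₁ E e = double₂ E e :=
  Subtype.ext (by
    change of e = t * of e * t⁻¹
    rw [(commute_t E he).eq, mul_inv_cancel_right])

theorem closure_double :
    Subgroup.closure (Set.range (double₁ E) ∪ Set.range (double₂ E)) = ⊤ := by
  apply Subgroup.map_injective (double E).subtype_injective
  rw [MonoidHom.map_closure, Set.image_union, ← Set.range_comp, ← Set.range_comp,
    ← MonoidHom.range_eq_map, (double E).range_subtype]
  apply le_antisymm
  · rw [Subgroup.closure_le]
    exact Set.union_subset (fun x hx => (le_sup_left : _ ≤ double E) hx)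
      fun x hx => (le_sup_right : _ ≤ double E) hx
  · refine sup_le ?_ ?_
    · exact fun x hx => Subgroup.subset_closure (Or.inl hx)
    · exact fun x hx => Subgroup.subset_closure (Or.inr hx)

theorem fg_double [Group.FG F] : Group.FG (double E) := by
  obtain ⟨S, hS, hfin⟩ := (Group.fg_iff (G := F)).1 inferInstance
  refine Group.fg_iff.2 ⟨double₁ E '' S ∪ double₂ E '' S, ?_,
    (hfin.image _).union (hfin.image _)⟩
  rw [Subgroup.closure_union, ← MonoidHom.map_closure, ← MonoidHom.map_closure, hS,
    ← MonoidHom.range_eq_map, ← MonoidHom.range_eq_map, ← closure_double, Subgroup.closure_union,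
    ← MonoidHom.coe_range, ← MonoidHom.coe_range, Subgroup.closure_eq, Subgroup.closure_eq]

theorem double_hom_ext {Q : Type*} [Group Q] {f g : double E →* Q}
    (h₁ : f.comp (double₁ E) = g.comp (double₁ E)) (h₂ : f.comp (double₂ E) = g.comp (double₂ E)) :
    f = g := by
  refine MonoidHom.eq_of_eqOn_dense (closure_double E) ?_
  rintro _ (⟨x, rfl⟩ | ⟨x, rfl⟩)
  · exact DFunLike.congr_fun h₁ x
  · exact DFunLike.congr_fun h₂ x

/-- The subgroup generated by the base group and its conjugate is the amalgam of two copies of the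
base group. -/
theorem exists_double_desc {Q : Type} [Group Q] (φ₁ φ₂ : F →* Q) (h : ∀ e ∈ E, φ₁ e = φ₂ e) :
    ∃ Φ : double E →* Q, Φ.comp (double₁ E) = φ₁ ∧ Φ.comp (double₂ E) = φ₂ := by
  let W := (Q × Q) ⋊[MonoidHom.id (MulAut (Q × Q))] MulAut (Q × Q)
  let σ : W := SemidirectProduct.inr (MulEquiv.prodComm : Q × Q ≃* Q × Q)
  have hσ : ∀ a b : Q, σ * SemidirectProduct.inl (a, b) * σ⁻¹ = SemidirectProduct.inl (b, a) := by
    intro a b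
    rw [← map_inv]
    exact (SemidirectProduct.inl_aut (φ := MonoidHom.id (MulAut (Q × Q)))
      (MulEquiv.prodComm : Q × Q ≃* Q × Q) (a, b)).symm
  let D : CentralizingExtension E →* W :=
    HNNOf.desc _ _ (SemidirectProduct.inl.comp (φ₁.prod φ₂)) σ (by
      rintro ⟨e, he⟩
      rw [← mul_inv_eq_iff_eq_mul]
      change σ * SemidirectProduct.inl (φ₁ e, φ₂ e) * σ⁻¹ = SemidirectProduct.inl (φ₁ e, φ₂ e)
      rw [hσ, h e he])
  have hD₁ : ∀ x, D (of x) = SemidirectProduct.inl (φ₁ x, φ₂ x) := fun x => by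
    rw [HNNOf.desc_of]
    rfl
  have hD₂ : ∀ x, D (conjOf E x) = SemidirectProduct.inl (φ₂ x, φ₁ x) := fun x => by
    rw [conjOf_apply, map_mul, map_mul, map_inv, hD₁, HNNOf.desc_t, hσ]
  have hright : double E ≤ (SemidirectProduct.rightHom.comp D).ker := by
    refine sup_le ?_ ?_
    · rintro _ ⟨x, rfl⟩
      rw [MonoidHom.mem_ker, MonoidHom.comp_apply, hD₁, SemidirectProduct.rightHom_inl]
    · rintro _ ⟨x, rfl⟩
      rw [MonoidHom.mem_ker, MonoidHom.comp_apply, hD₂, SemidirectProduct.rightHom_inl]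
  refine ⟨MonoidHom.mk' (fun x => (D x).left.1) ?_, ?_, ?_⟩
  · intro x y
    have hx : (D x).right = 1 := hright x.2
    have hmul : (D x * D y).left = (D x).left * (D x).right (D y).left := rfl
    rw [hx] at hmul
    simp only [Subgroup.coe_mul, map_mul, hmul]
    rfl
  · ext x
    change (D (of x)).left.1 = _
    rw [hD₁]
    rfl
  · ext x
    change (D (conjOf E x)).left.1 = _
    rw [hD₂]
    rfl

/-- A centralizing extension of a subgroup embeds compatibly. -/
theorem exists_injective_of_comap_eq {L : Type} [Group L] {ι : F →* L}
    (hι : Function.Injective ι) (M : Subgroup L) (hM : M.comap ι = E) :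
    ∃ ε : CentralizingExtension E →* CentralizingExtension M, Function.Injective ε := by
  have hmem : ∀ e ∈ E, ι e ∈ M := fun e he => by
    rw [← hM] at he
    exact he
  let ε : CentralizingExtension E →* CentralizingExtension M :=
    HNNOf.desc _ _ ((of).comp ι) t fun e => (commute_t M (hmem e e.2)).eq
  refine ⟨ε, (injective_iff_map_eq_one ε).2 fun x hx => ?_⟩
  have hof : ∀ k, ε (of k) = of (ι k) := fun k => HNNOf.desc_of _ _ _ _ _ _
  have hr : ∀ k, ι k ∈ M.subtype.range → k ∈ E.subtype.range := fun k hk => by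
    rw [Subgroup.range_subtype] at hk ⊢
    rwa [← hM]
  obtain ⟨k, rfl, -⟩ := exists_of_eq_of_map (j := ι) (g := 1) hof (HNNOf.desc_t _ _ _ _ _) hr hr
    (by rw [hx, map_one])
  rw [hof, ← map_one of] at hx
  rw [(map_eq_one_iff _ hι).1 ((map_eq_one_iff _ (of_injective _)).1 (hx.trans (map_one of))),
    map_one]

/-- If `Q` is the quotient of the amalgam of two copies of `F` along `E` by finitely many relations,
then `Q` embeds in a finitely presented group as the second factor of a rope. -/
theorem exists_rope [Group.FG F] {L Q : Type} [Group L] [Group Q] [Group.IsFinitelyPresented L]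
    {ε : CentralizingExtension E →* L} (hε : Function.Injective ε) {φ₁ φ₂ : F →* Q}
    (hφ₁ : Function.Surjective φ₁) (hφ : ∀ e ∈ E, φ₁ e = φ₂ e) {Z : Set (F × F)} (hZ : Z.Finite)
    (hZφ : ∀ z ∈ Z, φ₁ z.1 = φ₂ z.2)
    (huniv : ∀ (Q' : Type) [Group Q'] (ψ₁ ψ₂ : F →* Q'), (∀ e ∈ E, ψ₁ e = ψ₂ e) →
      (∀ z ∈ Z, ψ₁ z.1 = ψ₂ z.2) → ∃ Ψ : Q →* Q', Ψ.comp φ₁ = ψ₁ ∧ Ψ.comp φ₂ = ψ₂) :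
    ∃ (P : Type) (_ : Group P) (j : P →* L) (hj : Function.Injective j) (φ : P →* Q),
      Group.IsFinitelyPresented (Rope hj φ) := by
  have := fg_double E
  obtain ⟨Φ, hΦ₁, hΦ₂⟩ := exists_double_desc E φ₁ φ₂ hφ
  have hΦ₁' := DFunLike.congr_fun hΦ₁
  have hΦ₂' := DFunLike.congr_fun hΦ₂
  let w : F × F → double E := fun z => double₁ E z.1 * (double₂ E z.2)⁻¹
  refine ⟨double E, inferInstance, ε.comp (double E).subtype,
    hε.comp (double E).subtype_injective, Φ,
    Rope.isFinitelyPresented _ Φ (fun q => ?_) (hZ.image w) ?_⟩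
  · obtain ⟨x, rfl⟩ := hφ₁ q
    exact ⟨double₁ E x, hΦ₁' x⟩
  · apply le_antisymm
    · set N := Subgroup.normalClosure (w '' Z)
      obtain ⟨Ψ, hΨ₁, hΨ₂⟩ := huniv (double E ⧸ N) ((QuotientGroup.mk' N).comp (double₁ E))
        ((QuotientGroup.mk' N).comp (double₂ E))
        (fun e he => congrArg (QuotientGroup.mk' N) (double₁_eq_double₂ E he))
        (fun z hz => by
          rw [← mul_inv_eq_one]
          exact (QuotientGroup.eq_one_iff _).2 (Subgroup.subset_normalClosure ⟨z, hz, rfl⟩))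
      have key : Ψ.comp Φ = QuotientGroup.mk' N := by
        apply double_hom_ext
        · rw [MonoidHom.comp_assoc, hΦ₁, hΨ₁]
        · rw [MonoidHom.comp_assoc, hΦ₂, hΨ₂]
      intro x hx
      rw [← QuotientGroup.eq_one_iff]
      change QuotientGroup.mk' N x = 1
      rw [← key, MonoidHom.comp_apply, MonoidHom.mem_ker.1 hx, map_one]
    · refine Subgroup.normalClosure_le_normal ?_
      rintro _ ⟨z, hz, rfl⟩
      change Φ (double₁ E z.1 * (double₂ E z.2)⁻¹) = 1
      rw [map_mul, map_inv, mul_inv_eq_one]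
      exact (hΦ₁' z.1).trans ((hZφ z hz).trans (hΦ₂' z.2).symm)

end CentralizingExtension

section

open HNNExtension CentralizingExtension

/-- The centralizing extension of a benign set embeds in a finitely presented torsion-free group. -/
theorem IsBenign.exists_embedding {F : Type} [Group F] [Group.IsFinitelyPresented F]
    (hF : NoTorsion F) {E : Set F} (hE : IsBenign E) :
    ∃ (H : Type) (_ : Group H) (ι : CentralizingExtension (Subgroup.closure E) →* H),
      Group.IsFinitelyPresented H ∧ NoTorsion H ∧ Function.Injective ι := by
  obtain ⟨L, _, ι, M, hfp, htf, hι, hM, hcomap⟩ := hE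
  have := Group.IsFinitelyPresented.fg F
  have := Group.IsFinitelyPresented.fg (FreeStable F)
  have : Group.FG M := (Group.fg_iff_subgroup_fg M).2 hM
  obtain ⟨ε, hε⟩ := exists_injective_of_comap_eq (FreeStable.traceSubgroup E) hι M hcomap
  have hLM : Group.IsFinitelyPresented (CentralizingExtension M) :=
    HNNOf.isFinitelyPresented _ _
  obtain ⟨S, hS, hSfin⟩ := (Group.fg_iff (G := F)).1 inferInstance
  set X := CentralizingExtension (Subgroup.closure E)
  have hX : Subgroup.closure (Set.range (of : F →* X) ∪ {t}) = ⊤ := closure_range_of_union_t _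
  let φ₁ : FreeStable F →* X := FreeStable.desc of t
  let φ₂ : FreeStable F →* X := FreeStable.desc 1 t
  have hone : ∀ {Q : Type} [Group Q] (f : F →* Q) (q : Q),
      FreeStable.desc f q (FreeStable.conjT 1) = q := fun f q => by simp
  obtain ⟨P, _, j, hj, φ, hfp'⟩ := exists_rope (FreeStable.traceSubgroup E) hε (φ₁ := φ₁)
    (φ₂ := φ₂) (by
      rw [← MonoidHom.range_eq_top, eq_top_iff, ← hX, Subgroup.closure_le]
      rintro _ (⟨x, rfl⟩ | rfl)
      · exact ⟨SemidirectProduct.inr x, by simp [φ₁]⟩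
      · exact ⟨FreeStable.conjT 1, hone _ _⟩) (by
      have hle : FreeStable.traceSubgroup E ≤ φ₁.eqLocus φ₂ := by
        rw [FreeStable.traceSubgroup_eq, Subgroup.closure_le]
        rintro _ ⟨e, he, rfl⟩
        change φ₁ _ = φ₂ _
        simp only [φ₁, φ₂, FreeStable.desc_conjT, MonoidHom.one_apply, one_mul, inv_one, mul_one]
        rw [← (commute_t _ (Subgroup.subset_closure he)).eq, mul_inv_cancel_right]
      exact fun e he => hle he)
    (Z := (fun a => (1, SemidirectProduct.inr a)) '' S ∪ {(FreeStable.conjT 1, FreeStable.conjT 1)})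
    ((hSfin.image _).union (Set.finite_singleton _)) (by
      rintro _ (⟨a, -, rfl⟩ | rfl)
      · simp [φ₂]
      · simp only [φ₁, φ₂, hone]) (by
      intro Q' _ ψ₁ ψ₂ hψ hZ
      have hψt : ψ₁ (FreeStable.conjT 1) = ψ₂ (FreeStable.conjT 1) := hZ _ (Or.inr rfl)
      have hψ₂ : ψ₂.comp SemidirectProduct.inr = 1 := by
        refine MonoidHom.eq_of_eqOn_dense hS fun a ha => ?_
        have := hZ _ (Or.inl ⟨a, ha, rfl⟩)
        rw [map_one] at this
        exact this.symm
      have hconj : ∀ a : F, FreeStable.conjT a = SemidirectProduct.inr a * FreeStable.conjT 1 *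
          (SemidirectProduct.inr a)⁻¹ := fun a => by
        rw [FreeStable.inr_mul_conjT, mul_one]
      have hψ₂' : ∀ a, ψ₂ (SemidirectProduct.inr a) = 1 := DFunLike.congr_fun hψ₂
      have hψ₂c : ∀ a, ψ₂ (FreeStable.conjT a) = ψ₁ (FreeStable.conjT 1) := fun a => by
        rw [hconj, map_mul, map_mul, map_inv, hψ₂', hψt, one_mul, inv_one, mul_one]
      have hcomm : ∀ e ∈ Subgroup.closure E,
          ψ₁ (FreeStable.conjT 1) * ψ₁ (SemidirectProduct.inr e) =
            ψ₁ (SemidirectProduct.inr e) * ψ₁ (FreeStable.conjT 1) := by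
        intro e he
        have hle : Subgroup.closure E ≤ (Subgroup.centralizer
            {ψ₁ (FreeStable.conjT 1)}).comap (ψ₁.comp SemidirectProduct.inr) := by
          rw [Subgroup.closure_le]
          intro e he
          rw [SetLike.mem_coe, Subgroup.mem_comap, Subgroup.mem_centralizer_singleton_iff]
          have h1 := hψ (FreeStable.conjT e) (by
            rw [FreeStable.traceSubgroup_eq]
            exact Subgroup.subset_closure ⟨e, he, rfl⟩)
          rw [hψ₂c, hconj, map_mul, map_mul, map_inv, mul_inv_eq_iff_eq_mul] at h1
          exact h1
        exact (Subgroup.mem_centralizer_singleton_iff.1 (hle he)).symm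
      let Ψ : X →* Q' := HNNOf.desc _ _ (ψ₁.comp SemidirectProduct.inr)
        (ψ₁ (FreeStable.conjT 1)) fun e => hcomm e e.2
      have hΨ : ∀ a, Ψ (of a) = ψ₁ (SemidirectProduct.inr a) := fun a => HNNOf.desc_of _ _ _ _ _ _
      have hΨt : Ψ t = ψ₁ (FreeStable.conjT 1) := HNNOf.desc_t _ _ _ _ _
      refine ⟨Ψ, ?_, ?_⟩
      · refine MonoidHom.eq_of_eqOn_dense (FreeStable.closure_range_inr_union F) ?_
        rintro _ (⟨a, rfl⟩ | rfl)
        · simp [φ₁, hΨ]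
        · simp only [φ₁, MonoidHom.comp_apply, hone, hΨt]
      · refine MonoidHom.eq_of_eqOn_dense (FreeStable.closure_range_inr_union F) ?_
        rintro _ (⟨a, rfl⟩ | rfl)
        · simp [φ₂, hψ₂']
        · simp only [φ₂, MonoidHom.comp_apply, hone, hΨt, hψt])
  exact ⟨Rope hj φ, inferInstance, Rope.right hj φ, hfp',
    Rope.noTorsion hj φ (HNNExtension.noTorsion htf _) (HNNExtension.noTorsion hF _),
    Rope.right_injective hj φ⟩

/-- A group presented by a benign set of relators embeds in a finitely presented group with the same
torsion chain. -/
theorem IsBenign.exists_finitelyPresented {k : ℕ} {R E : Set (FreeGroup (Fin k))}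
    (hRE : R ⊆ E) (hER : E ⊆ Subgroup.closure R) (hE : IsBenign E) :
    ∃ (H : Type) (_ : Group H) (ι : PresentedGroup R →* H),
      Group.IsFinitelyPresented H ∧ Function.Injective ι ∧
        ∀ m, tor (PresentedGroup R) m = tor (PresentedGroup R) (m + 1) ↔
          tor H m = tor H (m + 1) := by
  obtain ⟨L, _, ε, hfp, htf, hε⟩ := hE.exists_embedding (noTorsion_of_isMulTorsionFree _)
  have hcl : Subgroup.closure E ≤ (PresentedGroup.mk R).ker := by
    rw [Subgroup.closure_le]
    refine hER.trans ?_
    rw [SetLike.coe_subset_coe, Subgroup.closure_le]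
    exact fun r hr => (QuotientGroup.eq_one_iff _).2 (Subgroup.subset_normalClosure hr)
  obtain ⟨P, _, j, hj, φ, hfp'⟩ := exists_rope (Subgroup.closure E) hε
    (φ₁ := PresentedGroup.mk R) (φ₂ := 1) (PresentedGroup.mk_surjective R)
    (fun e he => hcl he) (Z := Set.range fun i => (1, FreeGroup.of i)) (Set.finite_range _)
    (by
      rintro _ ⟨i, rfl⟩
      simp) (by
      intro Q' _ ψ₁ ψ₂ hψ hZ
      have hψ₂ : ψ₂ = 1 := by
        ext i
        have := hZ _ ⟨i, rfl⟩
        rw [map_one] at this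
        exact this.symm
      have hker : Subgroup.normalClosure R ≤ ψ₁.ker := by
        refine Subgroup.normalClosure_le_normal fun r hr => ?_
        have := hψ r (Subgroup.subset_closure (hRE hr))
        rw [hψ₂] at this
        exact this
      refine ⟨QuotientGroup.lift _ ψ₁ hker, ?_, ?_⟩
      · ext i
        rfl
      · rw [hψ₂]
        exact MonoidHom.ext fun _ => map_one (QuotientGroup.lift _ ψ₁ hker))
  exact ⟨Rope hj φ, inferInstance, Rope.right hj φ, hfp', Rope.right_injective hj φ,
    Rope.tor_eq_succ_iff hj φ htf⟩

end

open Monoid.Coprod in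
theorem Group.IsFinitelyPresented.prod (G H : Type*) [Group G] [Group H]
    [IsFinitelyPresented G] [IsFinitelyPresented H] : IsFinitelyPresented (G × H) := by
  have hG := Group.IsFinitelyPresented.fg G
  have hH := Group.IsFinitelyPresented.fg H
  obtain ⟨S, hS, hSfin⟩ := Group.fg_iff.1 hG
  obtain ⟨T, hT, hTfin⟩ := Group.fg_iff.1 hH
  let c : G × H → Monoid.Coprod G H := fun x => inl x.1 * inr x.2 * (inr x.2 * inl x.1)⁻¹
  let N := Subgroup.normalClosure (c '' S ×ˢ T)
  let π := QuotientGroup.mk' N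
  have hcomm : ∀ g h, Commute (π (inl g)) (π (inr h)) := by
    have h₁ : ∀ g ∈ S, ∀ h ∈ T, Commute (π (inl g)) (π (inr h)) := by
      intro g hg h hh
      have : π (c (g, h)) = 1 := (QuotientGroup.eq_one_iff _).2
        (Subgroup.subset_normalClosure ⟨(g, h), ⟨hg, hh⟩, rfl⟩)
      rw [map_mul, map_inv, mul_inv_eq_one, map_mul, map_mul] at this
      exact this
    have h₂ : ∀ g ∈ S, ∀ h, Commute (π (inl g)) (π (inr h)) := by
      intro g hg h
      have : (⊤ : Subgroup H) ≤
          (Subgroup.centralizer {π (inl g)}).comap (π.comp inr) := by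
        rw [← hT, Subgroup.closure_le]
        intro h hh
        simpa [Subgroup.mem_centralizer_iff] using (h₁ g hg h hh).eq
      have := this (Subgroup.mem_top h)
      simpa [Subgroup.mem_centralizer_iff, commute_iff_eq] using this
    intro g h
    have : (⊤ : Subgroup G) ≤ (Subgroup.centralizer {π (inr h)}).comap (π.comp inl) := by
      rw [← hS, Subgroup.closure_le]
      intro g hg
      simpa [Subgroup.mem_centralizer_iff] using (h₂ g hg h).symm.eq
    have := this (Subgroup.mem_top g)
    exact Commute.symm (by simpa [Subgroup.mem_centralizer_iff, commute_iff_eq] using this)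
  refine of_surjective (toProd : Monoid.Coprod G H →* G × H) toProd_surjective
    ⟨c '' S ×ˢ T, (hSfin.prod hTfin).image c, le_antisymm ?_ ?_⟩
  · refine Subgroup.normalClosure_le_normal ?_
    rintro _ ⟨⟨g, h⟩, -, rfl⟩
    simp [c, MonoidHom.mem_ker]
  · intro x hx
    have hfac : (MonoidHom.noncommCoprod (π.comp inl) (π.comp inr) hcomm).comp toProd = π :=
      Monoid.Coprod.hom_ext (by ext; simp) (by ext; simp)
    have := DFunLike.congr_fun hfac x
    rw [MonoidHom.comp_apply, (MonoidHom.mem_ker).1 hx, map_one] at this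
    exact (QuotientGroup.eq_one_iff _).1 this.symm

theorem isFinitelyPresented_multiplicative_pi_int (n : ℕ) :
    Group.IsFinitelyPresented (Multiplicative (Fin n → ℤ)) := by
  induction n with
  | zero => infer_instance
  | succ n ih =>
    have := Group.IsFinitelyPresented.prod (Multiplicative ℤ) (Multiplicative (Fin n → ℤ))
    let e : (ℤ × (Fin n → ℤ)) ≃+ (Fin (n + 1) → ℤ) :=
      { Fin.consEquiv (fun _ => ℤ) with
        map_add' := fun x y => by
          funext i
          refine Fin.cases ?_ (fun j => ?_) i <;> simp [Fin.consEquiv] }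
    exact Group.IsFinitelyPresented.equiv (G := Multiplicative ℤ × Multiplicative (Fin n → ℤ))
      ((MulEquiv.prodMultiplicative ℤ (Fin n → ℤ)).symm.trans e.toMultiplicative)

theorem isFinitelyPresented_multiplicative_int_of_finite (ι : Type*) [Finite ι] :
    Group.IsFinitelyPresented (Multiplicative (ι → ℤ)) := by
  obtain ⟨n, ⟨e⟩⟩ := Finite.exists_equiv_fin ι
  have := isFinitelyPresented_multiplicative_pi_int n
  exact Group.IsFinitelyPresented.equiv
    (AddEquiv.toMultiplicative
      (LinearEquiv.funCongrLeft ℤ ℤ e).toAddEquiv : Multiplicative (Fin n → ℤ) ≃* _)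

theorem noTorsion_multiplicative_pi_int (ι : Type*) : NoTorsion (Multiplicative (ι → ℤ)) := by
  intro g n hn h
  have : n • g.toAdd = 0 := h
  exact (smul_eq_zero.1 this).resolve_left (ne_of_gt hn)

/-- The numerical value of a stack in base `B`, with digits given by `d` and the top of the stack as
least significant digit. -/
def stackCode {Γ : Type*} (B : ℤ) (d : Γ → ℤ) : List Γ → ℤ
  | [] => 0
  | a :: l => B * stackCode B d l + d a

section stackCode

variable {Γ : Type*} {B : ℤ} {d : Γ → ℤ}

theorem stackCode_append (p l : List Γ) :
    stackCode B d (p ++ l) = B ^ p.length * stackCode B d l + stackCode B d p := by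
  induction p with
  | nil => simp [stackCode]
  | cons a p ih => simp only [List.cons_append, stackCode, ih, List.length_cons]; ring

theorem stackCode_eq_mul_add_iff (hd : ∀ a, 1 ≤ d a ∧ d a < B) (hinj : Function.Injective d)
    {p l : List Γ} {v : ℤ} :
    stackCode B d l = B ^ p.length * v + stackCode B d p →
      ∃ t, l = p ++ t ∧ stackCode B d t = v := by
  induction p generalizing l with
  | nil => exact fun h => ⟨l, rfl, by simpa [stackCode] using h⟩
  | cons a p ih =>
    intro h
    have hdvd : ∀ {x y s t : ℤ}, B * x + s = B * y + t → |t - s| < B → s = t ∧ x = y := by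
      intro x y s t h hlt
      have h0 := Int.eq_zero_of_abs_lt_dvd (⟨x - y, by linarith⟩ : B ∣ t - s) hlt
      have hB : B ≠ 0 := by have := abs_nonneg (t - s); omega
      exact ⟨by linarith, mul_left_cancel₀ hB (by linarith)⟩
    simp only [stackCode, List.length_cons, pow_succ'] at h
    have ha := hd a
    cases l with
    | nil =>
      have := (hdvd (x := 0) (y := B ^ p.length * v + stackCode B d p) (s := 0) (t := d a)
        (by simp only [stackCode] at h; linarith) (by rw [abs_lt]; omega)).1
      omega
    | cons b l =>
      have hb := hd b
      obtain ⟨h₁, h₂⟩ := hdvd (x := stackCode B d l) (y := B ^ p.length * v + stackCode B d p)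
        (s := d b) (t := d a) (by simp only [stackCode] at h; linarith) (by rw [abs_lt]; omega)
      obtain ⟨t, rfl, ht⟩ := ih h₂
      exact ⟨t, by rw [hinj h₁, List.cons_append], ht⟩

theorem stackCode_injective (hd : ∀ a, 1 ≤ d a ∧ d a < B) (hinj : Function.Injective d) :
    Function.Injective (stackCode B d) := by
  have hnil : ∀ l, stackCode B d l = 0 → l = [] := by
    intro l h
    cases l with
    | nil => rfl
    | cons a l =>
      obtain ⟨t, ht, -⟩ := stackCode_eq_mul_add_iff hd hinj (p := a :: l) (l := [])
        (v := 0) (by rw [h]; simp [stackCode])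
      simp at ht
  intro l l' h
  obtain ⟨t, rfl, ht⟩ := stackCode_eq_mul_add_iff hd hinj (p := l') (l := l) (v := 0) (by simpa)
  rw [hnil t ht, List.append_nil]

theorem exists_stackCode_digits (Γ : Type*) [Finite Γ] : ∃ (B : ℤ) (d : Γ → ℤ), B ≠ 0 ∧
    (∀ a, 1 ≤ d a ∧ d a < B) ∧ Function.Injective d := by
  obtain ⟨n, ⟨e⟩⟩ := Finite.exists_equiv_fin Γ
  refine ⟨n + 1, fun a => e a + 1, by omega, fun a => ?_, fun a b h => e.injective (Fin.ext ?_)⟩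
  · have := (e a).2
    constructor <;> push_cast <;> omega
  · simpa using h

end stackCode

/-- A rule of a machine with states `Q` and stacks indexed by `K`: it replaces the top segments
`pre` of the stacks by `post`, leaves the rest of each stack unchanged, requires this rest to be
empty on the stacks outside `free`, and multiplies an accumulator in `F` by `label`. -/
structure PrefixRule (Q K Γ F : Type) where
  src : Q
  tgt : Q
  pre : K → List Γ
  post : K → List Γ
  free : Set K
  label : F

namespace PrefixRule

variable {Q K Γ F : Type} [Group F]

/-- One application of a rule to a state, the stacks and the accumulator. -/
def Applies (r : PrefixRule Q K Γ F) (x y : (Q × (K → List Γ)) × F) : Prop :=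
  ∃ (T : K → List Γ) (w : F), (∀ k ∉ r.free, T k = []) ∧
    x = ((r.src, fun k => r.pre k ++ T k), w) ∧
    y = ((r.tgt, fun k => r.post k ++ T k), w * r.label)

end PrefixRule

theorem Relation.EqvGen.iff_of_step {X : Type*} {r : X → X → Prop} {P : X → Prop}
    (hP : ∀ x y, r x y → (P x ↔ P y)) {x y : X} (h : Relation.EqvGen r x y) : P x ↔ P y := by
  induction h with
  | rel x y hxy => exact hP x y hxy
  | refl => rfl
  | symm _ _ _ ih => exact ih.symm
  | trans _ _ _ _ _ ih₁ ih₂ => exact ih₁.trans ih₂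

/-- Integer vectors vanishing outside `s`. -/
def supportedVectors {K : Type} (s : Set K) : Submodule ℤ (K → ℤ) where
  carrier := {z | ∀ k ∉ s, z k = 0}
  add_mem' ha hb k hk := by simp [ha k hk, hb k hk]
  zero_mem' := fun _ _ => rfl
  smul_mem' c z hz k hk := by simp [hz k hk]

/-- Scaling the coordinates of an integer vector. -/
def scaleVectors {K : Type} (s : Set K) (c : K → ℤ) :
    Multiplicative (supportedVectors s) →* Multiplicative (K → ℤ) :=
  AddMonoidHom.toMultiplicative
    { toFun := fun z k => c k * z.1 k
      map_zero' := by ext; simp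
      map_add' := fun _ _ => by ext; simp [mul_add] }

theorem scaleVectors_injective {K : Type} (s : Set K) {c : K → ℤ} (hc : ∀ k, c k ≠ 0) :
    Function.Injective (scaleVectors s c) := fun _ _ h =>
  Multiplicative.toAdd.injective <| Subtype.ext <| funext fun k =>
    mul_left_cancel₀ (hc k) (congrFun (Multiplicative.ofAdd.injective h) k)

open Multiplicative in
/-- The set of accumulator values reachable at the initial state with empty stacks is benign. -/
theorem isBenign_prefixRules {Q K Γ F I : Type} [Group F] [Group.IsFinitelyPresented F]
    (hF : NoTorsion F) [Finite K] [Finite Γ] [Finite I] (r : I → PrefixRule Q K Γ F) (q₀ : Q) :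
    IsBenign {w : F | Relation.EqvGen (fun x y => ∃ i, (r i).Applies x y)
      ((q₀, fun _ => []), 1) ((q₀, fun _ => []), w)} := by
  classical
  obtain ⟨B, d, hB, hd, hinj⟩ := exists_stackCode_digits Γ
  have henc := stackCode_injective hd hinj
  let U : Set Q := insert q₀ (Set.range (fun i => (r i).src) ∪ Set.range fun i => (r i).tgt)
  have hU : U.Finite := ((Set.finite_range _).union (Set.finite_range _)).insert _
  obtain ⟨e, he₀, he⟩ : ∃ e : Q → ℤ, e q₀ = 0 ∧ Set.InjOn e U := by
    have : Countable U := hU.countable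
    obtain ⟨f, hf⟩ := exists_injective_nat U
    refine ⟨fun q => if h : q ∈ U then (f ⟨q, h⟩ : ℤ) - f ⟨q₀, Or.inl rfl⟩ else 0, ?_, ?_⟩
    · simp [U]
    · intro x hx y hy h
      simp only [hx, hy, dif_pos] at h
      have := @hf ⟨x, hx⟩ ⟨y, hy⟩ (by omega)
      simpa using this
  have hsrc : ∀ i, (r i).src ∈ U := fun i => Or.inr (Or.inl ⟨i, rfl⟩)
  have htgt : ∀ i, (r i).tgt ∈ U := fun i => Or.inr (Or.inr ⟨i, rfl⟩)
  have hfp := isFinitelyPresented_multiplicative_int_of_finite K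
  have hfp₁ := Group.IsFinitelyPresented.prod (Multiplicative (K → ℤ)) F
  have hfp₂ := Group.IsFinitelyPresented.prod (Multiplicative ℤ) (Multiplicative (K → ℤ) × F)
  have hfg : ∀ i, Group.FG (Multiplicative (supportedVectors (r i).free) × F) := by
    intro i
    have := Module.Finite.iff_addGroup_fg.1
      (inferInstance : Module.Finite ℤ (supportedVectors (r i).free))
    have := Group.IsFinitelyPresented.fg F
    infer_instance
  let C : (Q × (K → List Γ)) × F → Multiplicative ℤ × Multiplicative (K → ℤ) × F := fun x =>
    (ofAdd (e x.1.1), ofAdd fun k => stackCode B d (x.1.2 k), x.2)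
  have hC : ∀ x y, x.1.1 ∈ U → y.1.1 ∈ U → C x = C y → x = y := by
    rintro ⟨⟨q, L⟩, w⟩ ⟨⟨q', L'⟩, w'⟩ hx hy h
    simp only [C, Prod.mk.injEq, EmbeddingLike.apply_eq_iff_eq] at h
    obtain ⟨h₁, h₂, rfl⟩ := h
    obtain rfl := he hx hy h₁
    obtain rfl : L = L' := funext fun k => henc (congrFun h₂ k)
    rfl
  let α : ∀ i, Multiplicative (supportedVectors (r i).free) × F →*
      Multiplicative ℤ × Multiplicative (K → ℤ) × F := fun i =>
    (MonoidHom.inr _ _).comp (MonoidHom.prodMap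
      (scaleVectors (r i).free fun k => B ^ ((r i).pre k).length) (MonoidHom.id F))
  let β : ∀ i, Multiplicative (supportedVectors (r i).free) × F →*
      Multiplicative ℤ × Multiplicative (K → ℤ) × F := fun i =>
    (MonoidHom.inr _ _).comp (MonoidHom.prodMap
      (scaleVectors (r i).free fun k => B ^ ((r i).post k).length) (MonoidHom.id F))
  let g : I → Multiplicative ℤ × Multiplicative (K → ℤ) × F := fun i =>
    C (((r i).src, (r i).pre), 1)
  let h : I → Multiplicative ℤ × Multiplicative (K → ℤ) × F := fun i =>
    C (((r i).tgt, (r i).post), (r i).label)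
  have hinr : Function.Injective
      (MonoidHom.inr (Multiplicative ℤ) (Multiplicative (K → ℤ) × F)) :=
    fun _ _ h => congrArg Prod.snd h
  have hα : ∀ i, Function.Injective (α i) := fun i => hinr.comp
    (Function.Injective.prodMap (scaleVectors_injective _ fun _ => pow_ne_zero _ hB)
      Function.injective_id)
  have hβ : ∀ i, Function.Injective (β i) := fun i => hinr.comp
    (Function.Injective.prodMap (scaleVectors_injective _ fun _ => pow_ne_zero _ hB)
      Function.injective_id)
  have hαg : ∀ i z w, α i (ofAdd z, w) * g i = (ofAdd (e (r i).src),
      ofAdd fun k => B ^ ((r i).pre k).length * z.1 k + stackCode B d ((r i).pre k), w) := by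
    intro i z w
    refine Prod.ext (one_mul _) (Prod.ext rfl (mul_one _))
  have hβh : ∀ i z w, β i (ofAdd z, w) * h i = (ofAdd (e (r i).tgt),
      ofAdd fun k => B ^ ((r i).post k).length * z.1 k + stackCode B d ((r i).post k),
      w * (r i).label) := by
    intro i z w
    exact Prod.ext (one_mul _) (Prod.ext rfl rfl)
  have horbit := isBenign_orbit (((noTorsion_of_isMulTorsionFree (Multiplicative ℤ)).prod
    ((noTorsion_multiplicative_pi_int K).prod hF))) α β g h hα hβ 1
  let γ : F →* Multiplicative ℤ × Multiplicative (K → ℤ) × F :=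
    (MonoidHom.inr _ _).comp (MonoidHom.inr _ _)
  have hγ : Function.Injective γ := fun x y h => congrArg (fun z => z.2.2) h
  have hγC : ∀ w, γ w = C ((q₀, fun _ => []), w) := by
    intro w
    simp only [C, he₀]
    rfl
  convert horbit.preimage hγ using 1
  have hstep : ∀ i (T : K → List Γ) (w : F), (∀ k ∉ (r i).free, T k = []) →
      ∃ a, C (((r i).src, fun k => (r i).pre k ++ T k), w) = α i a * g i ∧
        C (((r i).tgt, fun k => (r i).post k ++ T k), w * (r i).label) = β i a * h i := by
    intro i T w hT
    refine ⟨(ofAdd ⟨fun k => stackCode B d (T k), fun k hk => ?_⟩, w), ?_, ?_⟩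
    · exact congrArg (stackCode B d) (hT k hk)
    · rw [hαg]
      simp only [C, stackCode_append]
    · rw [hβh]
      simp only [C, stackCode_append]
  have hback : ∀ (p : K → List Γ) (s : Set K) (z : supportedVectors s) (L : K → List Γ),
      (∀ k, stackCode B d (L k) = B ^ (p k).length * z.1 k + stackCode B d (p k)) →
      ∃ T : K → List Γ, (∀ k ∉ s, T k = []) ∧ (∀ k, stackCode B d (T k) = z.1 k) ∧
        L = fun k => p k ++ T k := by
    intro p s z L hL
    choose T hT₁ hT₂ using fun k => stackCode_eq_mul_add_iff hd hinj (hL k)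
    refine ⟨T, fun k hk => henc ?_, hT₂, funext hT₁⟩
    rw [hT₂ k, z.2 k hk]
    rfl
  let base : (Q × (K → List Γ)) × F := ((q₀, fun _ => []), 1)
  let P : Multiplicative ℤ × Multiplicative (K → ℤ) × F → Prop := fun a =>
    ∃ x, a = C x ∧ x.1.1 ∈ U ∧ Relation.EqvGen (fun x y => ∃ i, (r i).Applies x y) base x
  have hP : ∀ a b, AffineStep α β g h a b → (P a ↔ P b) := by
    rintro _ _ ⟨i, ⟨z, w⟩, rfl, rfl⟩
    obtain ⟨z, rfl⟩ := ofAdd.surjective z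
    constructor
    · rintro ⟨⟨⟨q, L⟩, w'⟩, hx, hq, hx'⟩
      rw [hαg] at hx
      simp only [C, Prod.mk.injEq, EmbeddingLike.apply_eq_iff_eq] at hx
      obtain ⟨h₁, h₂, rfl⟩ := hx
      obtain rfl := he (hsrc i) hq h₁
      obtain ⟨T, hT, hTz, rfl⟩ := hback _ _ z L fun k => (congrFun h₂ k).symm
      refine ⟨(((r i).tgt, fun k => (r i).post k ++ T k), w * (r i).label), ?_, htgt i,
        .trans _ _ _ hx' (.rel _ _ ⟨i, T, w, hT, rfl, rfl⟩)⟩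
      rw [hβh]
      simp only [C, stackCode_append, hTz]
    · rintro ⟨⟨⟨q, L⟩, w'⟩, hx, hq, hx'⟩
      rw [hβh] at hx
      simp only [C, Prod.mk.injEq, EmbeddingLike.apply_eq_iff_eq] at hx
      obtain ⟨h₁, h₂, rfl⟩ := hx
      obtain rfl := he (htgt i) hq h₁
      obtain ⟨T, hT, hTz, rfl⟩ := hback _ _ z L fun k => (congrFun h₂ k).symm
      refine ⟨(((r i).src, fun k => (r i).pre k ++ T k), w), ?_, hsrc i,
        .trans _ _ _ hx' (.symm _ _ (.rel _ _ ⟨i, T, w, hT, rfl, rfl⟩))⟩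
      rw [hαg]
      simp only [C, stackCode_append, hTz]
  ext w
  rw [Set.mem_preimage, Set.mem_ofPred_eq, Set.mem_ofPred_eq, hγC]
  have h1 : (1 : Multiplicative ℤ × Multiplicative (K → ℤ) × F) = C base := by
    rw [← hγC, map_one]
  constructor
  · intro hw
    rw [h1]
    refine ((Relation.EqvGen.iff_of_step (P := fun x => Relation.EqvGen (AffineStep α β g h)
      (C base) (C x)) ?_ hw).1 (.refl _))
    rintro _ _ ⟨i, T, w, hT, rfl, rfl⟩
    obtain ⟨a, ha₁, ha₂⟩ := hstep i T w hT
    have : Relation.EqvGen (AffineStep α β g h) _ _ := .rel _ _ ⟨i, a, ha₁, ha₂⟩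
    exact ⟨fun hx => .trans _ _ _ hx this, fun hx => .trans _ _ _ hx (.symm _ _ this)⟩
  · intro hw
    obtain ⟨x, hx, hxU, hx'⟩ := (Relation.EqvGen.iff_of_step hP hw).1
      ⟨base, h1, Or.inl rfl, .refl _⟩
    rwa [hC _ _ (Or.inl rfl) hxU hx]

/-- An encoding of words as binary numbers: each letter `a` is a block of `encode a` digits `1`
followed by the digit `0`, starting from the least significant end. -/
def PosNum.ofWord {α : Type*} [Encodable α] (l : List α) : PosNum :=
  l.foldr (fun a p => PosNum.bit1^[Encodable.encode a] (PosNum.bit0 p)) PosNum.one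

theorem PosNum.primrec_ofWord {α : Type*} [Primcodable α] :
    Primrec fun l : List α => (PosNum.ofWord l : ℕ) := by
  have h : Primrec fun l : List α =>
      l.foldr (fun a n => (fun x => 2 * x + 1)^[Encodable.encode a] (2 * n)) 1 := by
    have hstep : Primrec fun x : List α × α × ℕ =>
        (fun m => 2 * m + 1)^[Encodable.encode x.2.1] (2 * x.2.2) :=
      Primrec.nat_iterate (Primrec.encode.comp (Primrec.fst.comp .snd))
        (Primrec.nat_mul.comp (.const 2) (Primrec.snd.comp .snd))
        (Primrec.nat_add.comp (Primrec.nat_mul.comp (.const 2) .snd) (.const 1))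
    exact Primrec.list_foldr .id (.const 1) hstep.to₂
  refine h.of_eq fun l => ?_
  induction l with
  | nil => rfl
  | cons a l ih =>
    have hit : ∀ (n : ℕ) (p : PosNum), ((PosNum.bit1^[n] p : PosNum) : ℕ) =
        (fun x => 2 * x + 1)^[n] (p : ℕ) := by
      intro n
      induction n with
      | zero => exact fun _ => rfl
      | succ n ih' =>
        intro p
        rw [Function.iterate_succ_apply, Function.iterate_succ_apply, ih', PosNum.cast_bit1]
        congr 1
        ring
    rw [List.foldr_cons, ih, two_mul]
    exact (hit _ (PosNum.ofWord l).bit0).symm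

open Turing in
/-- A computable sequence of words is computed by a program in the basis `ToPartrec.Code`. -/
theorem exists_code_ofWord {α : Type*} [Primcodable α] {f : ℕ → List α} (hf : Computable f) :
    ∃ c : ToPartrec.Code, ∀ n, c.eval [n + 1] = Part.some [(PosNum.ofWord (f n) : ℕ)] := by
  have hg : Computable fun n => (PosNum.ofWord (f (n - 1)) : ℕ) :=
    PosNum.primrec_ofWord.to_comp.comp (hf.comp Primrec.pred.to_comp)
  obtain ⟨c, hc⟩ := ToPartrec.Code.exists_code (Nat.Partrec'.part_iff₁.2 hg)
  refine ⟨c, fun n => ?_⟩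
  exact (hc ⟨[n + 1], rfl⟩).trans (Part.map_some _ _)

namespace Turing.PartrecToTM2

theorem trNat_posNum (p : PosNum) : trNat (p : ℕ) = trPosNum p := by
  rw [trNat, PosNum.of_to_nat]
  rfl

end Turing.PartrecToTM2

theorem PosNum.exists_cast_eq_succ (n : ℕ) : ∃ p : PosNum, (p : ℕ) = n + 1 := by
  induction n with
  | zero => exact ⟨1, rfl⟩
  | succ n ih =>
    obtain ⟨p, hp⟩ := ih
    exact ⟨p.succ, by rw [PosNum.succ_to_nat, hp]⟩

/-- `LoopLabel edge isBase b x l`: some path from `x` to `b`, meeting `isBase` at most at its end,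
has the product of its labels equal to `l`. -/
inductive LoopLabel {X F : Type*} [Monoid F] (edge : X → F → X → Prop) (isBase : X → Prop) (b : X) :
    X → F → Prop
  | nil : LoopLabel edge isBase b b 1
  | cons {x y : X} {l m : F} : ¬ isBase x → edge x l y → LoopLabel edge isBase b y m →
      LoopLabel edge isBase b x (l * m)

namespace LoopLabel

variable {X F : Type*} [Group F] {edge : X → F → X → Prop} {isBase : X → Prop} {b : X}

theorem eq_one {x : X} {l : F} (h : LoopLabel edge isBase b x l) (hx : isBase x) : l = 1 := by
  cases h with
  | nil => rfl
  | cons hx' => exact absurd hx hx'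

theorem exists_of_edge (hb : isBase b)
    (hdet : ∀ x y y' l l', ¬ isBase x → edge x l y → edge x l' y' → l = l' ∧ y = y')
    {x y : X} {l m : F} (hx : ¬ isBase x) (hxy : edge x l y) (h : LoopLabel edge isBase b x m) :
    ∃ m', LoopLabel edge isBase b y m' ∧ m = l * m' := by
  cases h with
  | nil => exact absurd hb hx
  | cons _ hxz h' =>
    obtain ⟨rfl, rfl⟩ := hdet _ _ _ _ _ hx hxy hxz
    exact ⟨_, h', rfl⟩

theorem unique (hb : isBase b)
    (hdet : ∀ x y y' l l', ¬ isBase x → edge x l y → edge x l' y' → l = l' ∧ y = y')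
    {x : X} {l m : F} (h : LoopLabel edge isBase b x l) (h' : LoopLabel edge isBase b x m) :
    l = m := by
  induction h generalizing m with
  | nil => exact (h'.eq_one hb).symm
  | cons hx hxy _ ih =>
    obtain ⟨m', hm', rfl⟩ := h'.exists_of_edge hb hdet hx hxy
    rw [ih hm']

/-- In a labelled graph that is deterministic outside the base points, the labels of closed walks
at `b`, traversing edges in both directions, lie in any subgroup containing the labels of the loops
that start with an edge leaving the base points. -/
theorem mem_of_eqvGen (hb : isBase b) {N : Subgroup F}
    (hdet : ∀ x y y' l l', ¬ isBase x → edge x l y → edge x l' y' → l = l' ∧ y = y')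
    (hbase : ∀ x l y, isBase x → edge x l y → l = 1)
    (hret : ∀ x l y, ¬ isBase x → isBase y → edge x l y → y = b)
    (hloop : ∀ x l y, isBase x → ¬ isBase y → edge x l y → ∃ m ∈ N, LoopLabel edge isBase b y m)
    {w : F} (h : Relation.EqvGen (fun x y : X × F => edge x.1 (x.2⁻¹ * y.2) y.1) (b, 1) (b, w)) :
    w ∈ N := by
  let P : X × F → Prop := fun x =>
    (isBase x.1 ∧ x.2 ∈ N) ∨ (¬ isBase x.1 ∧ ∃ m, LoopLabel edge isBase b x.1 m ∧ x.2 * m ∈ N)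
  have hP : ∀ x y : X × F, edge x.1 (x.2⁻¹ * y.2) y.1 → (P x ↔ P y) := by
    rintro ⟨x, w⟩ ⟨y, w'⟩ hxy
    obtain ⟨l, rfl⟩ : ∃ l, w' = w * l := ⟨w⁻¹ * w', by group⟩
    simp only [inv_mul_cancel_left] at hxy
    by_cases hx : isBase x <;> by_cases hy : isBase y
    · obtain rfl := hbase _ _ _ hx hxy
      simp [P, hx, hy]
    · obtain rfl := hbase _ _ _ hx hxy
      obtain ⟨m, hm, hym⟩ := hloop _ _ _ hx hy hxy
      simp only [P, hx, hy, true_and, not_true_eq_false, false_and, or_false, mul_one,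
        not_false_eq_true, false_or]
      constructor
      · exact fun hw => ⟨m, hym, mul_mem hw hm⟩
      · rintro ⟨m', hym', hw⟩
        rw [hym'.unique hb hdet hym] at hw
        exact (Subgroup.mul_mem_cancel_right N hm).1 hw
    · obtain rfl := hret _ _ _ hx hy hxy
      simp only [P, hx, hy, true_and, not_true_eq_false, false_and, or_false,
        not_false_eq_true, false_or]
      constructor
      · rintro ⟨m, hm, hw⟩
        obtain ⟨m', hm', rfl⟩ := hm.exists_of_edge hb hdet hx hxy
        rwa [hm'.eq_one hb, mul_one] at hw
      · exact fun hw => ⟨l * 1, .cons hx hxy .nil, by rwa [mul_one]⟩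
    · simp only [P, hx, hy, not_false_eq_true, false_and, true_and, false_or]
      constructor
      · rintro ⟨m, hm, hw⟩
        obtain ⟨m', hm', rfl⟩ := hm.exists_of_edge hb hdet hx hxy
        exact ⟨m', hm', by rwa [mul_assoc]⟩
      · rintro ⟨m, hm, hw⟩
        exact ⟨l * m, .cons hx hxy hm, by rwa [← mul_assoc]⟩
  have := (h.iff_of_step hP).1 (Or.inl ⟨hb, one_mem N⟩)
  simpa [P, hb] using this

/-- A loop contributes its label to the orbit of the accumulator. -/
theorem eqvGen {x : X} {m : F} (h : LoopLabel edge isBase b x m) (w : F) :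
    Relation.EqvGen (fun x y : X × F => edge x.1 (x.2⁻¹ * y.2) y.1) (x, w) (b, w * m) := by
  induction h generalizing w with
  | nil => rw [mul_one]; exact .refl _
  | cons _ hxy _ ih =>
    rw [← mul_assoc]
    exact .trans _ _ _ (.rel _ _ (by simpa using hxy)) (ih _)

end LoopLabel

namespace PrefixRule

variable {Q K Γ F : Type}

/-- The effect of a rule on states and stacks. -/
def Edge (r : PrefixRule Q K Γ F) (x y : Q × (K → List Γ)) : Prop :=
  ∃ T : K → List Γ, (∀ k ∉ r.free, T k = []) ∧
    x = (r.src, fun k => r.pre k ++ T k) ∧ y = (r.tgt, fun k => r.post k ++ T k)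

theorem applies_iff [Group F] {r : PrefixRule Q K Γ F} {x y : (Q × (K → List Γ)) × F} :
    r.Applies x y ↔ r.Edge x.1 y.1 ∧ x.2⁻¹ * y.2 = r.label := by
  constructor
  · rintro ⟨T, w, hT, rfl, rfl⟩
    exact ⟨⟨T, hT, rfl, rfl⟩, inv_mul_cancel_left _ _⟩
  · rcases x with ⟨x, w⟩
    rcases y with ⟨y, w'⟩
    rintro ⟨⟨T, hT, rfl, rfl⟩, h⟩
    exact ⟨T, w, hT, rfl, by rw [← h, mul_inv_cancel_left]⟩

variable [DecidableEq K]

/-- The rule that inspects the stack `k`, applies if its top symbol is `o`, replaces this symbol by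
the word `out`, and goes from the state `q` to the state `q'`. -/
def read (q : Q) (k : K) (o : Option Γ) (out : List Γ) (q' : Q) (l : F) : PrefixRule Q K Γ F where
  src := q
  tgt := q'
  pre := Function.update (fun _ => []) k o.toList
  post := Function.update (fun _ => []) k out
  free := {j | j = k → o.isSome}
  label := l

theorem edge_read {q q' : Q} {k : K} {o : Option Γ} {out : List Γ} {l : F}
    {x y : Q × (K → List Γ)} : (read q k o out q' l).Edge x y ↔ x.1 = q ∧ (x.2 k).head? = o ∧
      y = (q', Function.update x.2 k (out ++ (x.2 k).tail)) := by
  constructor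
  · rintro ⟨T, hT, rfl, rfl⟩
    refine ⟨rfl, ?_, ?_⟩
    · cases o with
      | some a => simp [read]
      | none => simpa [read] using hT k (by simp [read])
    · refine Prod.ext rfl (funext fun j => ?_)
      rcases eq_or_ne j k with rfl | hj
      · cases o with
        | some a => simp [read]
        | none => simp [read, hT j (by simp [read])]
      · simp [read, hj]
  · rcases x with ⟨q, S⟩
    rintro ⟨rfl, ho, rfl⟩
    refine ⟨Function.update S k (S k).tail, fun j hj => ?_, ?_, ?_⟩
    · simp only [read, Set.mem_ofPred_eq, not_forall] at hj
      obtain ⟨rfl, hj⟩ := hj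
      obtain rfl : o = none := by simpa using hj
      have hS : S j = [] := List.head?_eq_none_iff.1 ho
      simp [hS]
    · refine Prod.ext rfl (funext fun j => ?_)
      rcases eq_or_ne j k with rfl | hj
      · subst ho
        cases h : S j <;> simp [read, h]
      · simp [read, hj]
    · refine Prod.ext rfl (funext fun j => ?_)
      rcases eq_or_ne j k with rfl | hj <;> simp [read, *]

end PrefixRule

namespace Turing.PartrecToTM2

instance : Finite K' :=
  Finite.of_injective (fun k : K' => match k with
    | .main => Γ'.consₗ
    | .rev => Γ'.cons
    | .aux => Γ'.bit0
    | .stack => Γ'.bit1) fun a b h => by cases a <;> cases b <;> simp_all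

/-- The statements of the stack machine evaluating partial recursive functions. -/
abbrev Statement : Type :=
  TM2.Stmt (fun _ : K' => Γ') Λ' (Option Γ')

/-- The states of a machine that guesses a number, evaluates a partial recursive function on it, and
reads off the letters of the word encoded by the result. -/
inductive LoopState : Type
  | build
  | start
  | copy
  | put (a : Γ')
  | run (q : Statement) (s : Option Γ')
  | dec (j : ℕ)
  | fin

open LoopState

variable {F : Type} [Group F]

/-- The action of the deterministic states: the inspected stack and, depending on its top symbol,
the word replacing it, the next state and the label. -/
def act (entry : Statement) (letter : ℕ → F) :
    LoopState → K' × (Option Γ' → Option (List Γ' × LoopState × F))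
  | build => (.main, fun _ => none)
  | start => (.main, fun o => some (.bit1 :: .cons :: o.toList, copy, 1))
  | copy => (.aux, fun o => match o with
    | none => some ([], run entry none, 1)
    | some a => some ([], put a, 1))
  | put a => (.main, fun o => some ((if a = .bit1 then .bit1 else .bit0) :: o.toList, copy, 1))
  | run (.push k f q) s => (k, fun o => some (f s :: o.toList, run q s, 1))
  | run (.peek k f q) s => (k, fun o => some (o.toList, run q (f s o), 1))
  | run (.pop k f q) s => (k, fun o => some ([], run q (f s o), 1))
  | run (.load f q) s => (.main, fun o => some (o.toList, run q (f s), 1))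
  | run (.branch p q₁ q₂) s => (.main, fun o => some (o.toList, run (cond (p s) q₁ q₂) s, 1))
  | run (.goto l) s => (.main, fun o => some (o.toList, run (tr (l s)) s, 1))
  | run .halt _ => (.main, fun o => some (o.toList, dec 0, 1))
  | dec j => (.main, fun o => match o with
    | some .bit1 => some ([], dec (j + 1), 1)
    | some .bit0 => some ([], dec 0, letter j)
    | some .cons => some ([], fin, 1)
    | _ => none)
  | fin => (.main, fun _ => none)

theorem act_ne_build (entry : Statement) (letter : ℕ → F) {q : LoopState} {o : Option Γ'}
    {out : List Γ'} {l : F} : (act entry letter q).2 o ≠ some (out, build, l) := by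
  intro h
  unfold act at h
  split at h <;> first | (dsimp only at h; split at h <;> simp at h) | simp at h

/-- Push a symbol on the stack of the number being guessed. -/
def pushRule (a : Γ') : PrefixRule LoopState K' Γ' F where
  src := build
  tgt := build
  pre := fun _ => []
  post := K'.elim [] [] [a] []
  free := Set.univ
  label := 1

/-- Stop guessing. -/
def startRule : PrefixRule LoopState K' Γ' F where
  src := build
  tgt := start
  pre := fun _ => []
  post := fun _ => []
  free := {.aux}
  label := 1

/-- Go back to the initial configuration. -/
def returnRule : PrefixRule LoopState K' Γ' F where
  src := fin
  tgt := build
  pre := fun _ => []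
  post := fun _ => []
  free := ∅
  label := 1

/-- The rule of a deterministic state for a given top symbol. -/
def actRule (entry : Statement) (letter : ℕ → F) (x : LoopState × Option Γ') :
    PrefixRule LoopState K' Γ' F :=
  match (act entry letter x.1).2 x.2 with
  | some (out, q', l) => .read x.1 (act entry letter x.1).1 x.2 out q' l
  | none => returnRule

/-- The rules of the machine, restricted to a set of states. -/
def loopRules (entry : Statement) (letter : ℕ → F) (U : Set LoopState) :
    Set (PrefixRule LoopState K' Γ' F) :=
  actRule entry letter '' U ×ˢ Set.univ ∪
    {pushRule .bit0, pushRule .bit1, startRule, returnRule}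

theorem finite_loopRules (entry : Statement) (letter : ℕ → F) {U : Set LoopState} (hU : U.Finite) :
    (loopRules entry letter U).Finite :=
  ((hU.prod Set.finite_univ).image _).union (Set.toFinite _)

/-- The labelled graph of configurations of the machine. -/
def LoopEdge (entry : Statement) (letter : ℕ → F) (U : Set LoopState)
    (x : LoopState × (K' → List Γ')) (l : F) (y : LoopState × (K' → List Γ')) : Prop :=
  ∃ r ∈ loopRules entry letter U, r.Edge x y ∧ l = r.label

variable {entry : Statement} {letter : ℕ → F} {U : Set LoopState}
  {x y : LoopState × (K' → List Γ')} {l : F}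

theorem LoopEdge.cases (h : LoopEdge entry letter U x l y) :
    (x.1 = build ∧ y.1 = build ∧ l = 1) ∨
    (∃ T, x = (build, K'.elim [] [] T []) ∧ y = (start, K'.elim [] [] T []) ∧ l = 1) ∨
    (x = (fin, fun _ => []) ∧ y = (build, fun _ => []) ∧ l = 1) ∨
    ∃ out q, (act entry letter x.1).2 (x.2 (act entry letter x.1).1).head? = some (out, q, l) ∧
      y = (q, Function.update x.2 (act entry letter x.1).1
        (out ++ (x.2 (act entry letter x.1).1).tail)) := by
  have hret : (returnRule : PrefixRule LoopState K' Γ' F).Edge x y →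
      x = (fin, fun _ => []) ∧ y = (build, fun _ => []) := by
    rintro ⟨T, hT, rfl, rfl⟩
    obtain rfl : T = fun _ => [] := funext fun k => hT k (by simp [returnRule])
    exact ⟨rfl, rfl⟩
  obtain ⟨r, ⟨⟨q, o⟩, -, rfl⟩ | hr, hxy, rfl⟩ := h
  · revert hxy
    cases hact : (act entry letter q).2 o with
    | none =>
      simp only [actRule, hact]
      exact fun h => Or.inr (Or.inr (Or.inl ⟨(hret h).1, (hret h).2, rfl⟩))
    | some z =>
      obtain ⟨out, q', l⟩ := z
      simp only [actRule, hact, PrefixRule.edge_read]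
      rintro ⟨rfl, rfl, rfl⟩
      exact Or.inr (Or.inr (Or.inr ⟨_, _, hact, rfl⟩))
  · rcases hr with rfl | rfl | rfl | rfl
    · obtain ⟨T, hT, rfl, rfl⟩ := hxy
      exact Or.inl ⟨rfl, rfl, rfl⟩
    · obtain ⟨T, hT, rfl, rfl⟩ := hxy
      exact Or.inl ⟨rfl, rfl, rfl⟩
    · obtain ⟨T, hT, rfl, rfl⟩ := hxy
      have hT' : T = K'.elim [] [] (T .aux) [] := by
        funext k
        cases k
        all_goals first | rfl | exact hT _ (by simp [startRule])
      exact Or.inr (Or.inl ⟨T .aux, Prod.ext rfl hT', Prod.ext rfl hT', rfl⟩)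
    · exact Or.inr (Or.inr (Or.inl ⟨(hret hxy).1, (hret hxy).2, rfl⟩))

theorem LoopEdge.det {y' : LoopState × (K' → List Γ')} {l' : F} (hx : x.1 ≠ build)
    (h : LoopEdge entry letter U x l y) (h' : LoopEdge entry letter U x l' y') :
    l = l' ∧ y = y' := by
  rcases h.cases with ⟨h₁, -⟩ | ⟨T, rfl, -⟩ | ⟨rfl, rfl, rfl⟩ | ⟨out, q, hact, rfl⟩
  · exact absurd h₁ hx
  · exact absurd rfl hx
  · rcases h'.cases with ⟨h₁, -⟩ | ⟨T, h₁, -⟩ | ⟨-, rfl, rfl⟩ | ⟨out, q, hact, rfl⟩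
    · cases h₁
    · cases h₁
    · exact ⟨rfl, rfl⟩
    · simp [act] at hact
  · rcases h'.cases with ⟨h₁, -⟩ | ⟨T, rfl, -⟩ | ⟨rfl, rfl, rfl⟩ | ⟨out', q', hact', rfl⟩
    · exact absurd h₁ hx
    · exact absurd rfl hx
    · simp [act] at hact
    · rw [hact] at hact'
      simp only [Option.some.injEq, Prod.mk.injEq] at hact'
      obtain ⟨rfl, rfl, rfl⟩ := hact'
      exact ⟨rfl, rfl⟩

/-- Loops of the machine at the initial configuration. -/
abbrev MachineLoop (entry : Statement) (letter : ℕ → F) (U : Set LoopState) :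
    LoopState × (K' → List Γ') → F → Prop :=
  LoopLabel (LoopEdge entry letter U) (fun x => x.1 = build) (build, fun _ => [])

theorem MachineLoop.of_act {q q' : LoopState} {S : K' → List Γ'} {out : List Γ'} {m : F}
    (hq : q ∈ U)
    (hact : (act entry letter q).2 (S (act entry letter q).1).head? = some (out, q', l))
    (h : MachineLoop entry letter U (q', Function.update S (act entry letter q).1
      (out ++ (S (act entry letter q).1).tail)) m) :
    MachineLoop entry letter U (q, S) (l * m) := by
  refine LoopLabel.cons ?_ ⟨actRule entry letter (q, (S (act entry letter q).1).head?),
    Or.inl ⟨_, ⟨hq, trivial⟩, rfl⟩, ?_, ?_⟩ h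
  · rintro rfl
    simp [act] at hact
  · simp [actRule, hact, PrefixRule.edge_read]
  · simp [actRule, hact, PrefixRule.read]

end Turing.PartrecToTM2

namespace Turing.PartrecToTM2

open LoopState

namespace MachineLoop

variable {F : Type} [Group F] {entry : Statement} {letter : ℕ → F} {U : Set LoopState}

theorem of_act_one {q q' : LoopState} {S : K' → List Γ'} {out : List Γ'} {m : F}
    (hq : q ∈ U)
    (hact : (act entry letter q).2 (S (act entry letter q).1).head? = some (out, q', 1))
    (h : MachineLoop entry letter U (q', Function.update S (act entry letter q).1
      (out ++ (S (act entry letter q).1).tail)) m) :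
    MachineLoop entry letter U (q, S) m := by
  have := of_act hq hact h
  rwa [one_mul] at this

theorem fin : MachineLoop entry letter U (fin, fun _ => []) 1 := by
  rw [← mul_one (1 : F)]
  refine LoopLabel.cons (by simp) ⟨returnRule, by simp [loopRules],
    ⟨fun _ => [], ?_, rfl, rfl⟩, rfl⟩
    .nil
  exact fun _ _ => rfl

variable {α : Type} [Encodable α] {J : ℕ}

theorem dec_iterate (hU : ∀ j ≤ J, dec j ∈ U) {n j : ℕ} (hj : j + n ≤ J) {p : PosNum} {m : F}
    (h : MachineLoop entry letter U
      (dec 0, K'.elim (trPosNum p ++ [.cons]) [] [] []) m) :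
    MachineLoop entry letter U
      (dec j, K'.elim (trPosNum (PosNum.bit1^[n] (PosNum.bit0 p)) ++ [.cons]) [] [] [])
      (letter (j + n) * m) := by
  induction n generalizing j with
  | zero =>
    refine of_act (hU j hj) rfl ?_
    simpa [act, trPosNum] using h
  | succ n ih =>
    rw [Function.iterate_succ_apply']
    refine of_act_one (hU j (by omega)) rfl ?_
    have := ih (j := j + 1) (by omega)
    rw [add_right_comm, add_assoc] at this
    simpa [act, trPosNum] using this

theorem dec_ofWord (hU : ∀ j ≤ J, dec j ∈ U) (hJ : 1 ≤ J) (hα : ∀ a : α, Encodable.encode a ≤ J)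
    (ls : List α) :
    MachineLoop entry letter U
      (dec 0, K'.elim (trPosNum (PosNum.ofWord ls) ++ [.cons]) [] [] [])
      (ls.map fun a => letter (Encodable.encode a)).prod := by
  induction ls with
  | nil =>
    refine of_act_one (hU 0 (by omega)) rfl ?_
    refine of_act_one (hU 1 hJ) rfl ?_
    convert fin using 2
    · funext k
      cases k <;> simp [act, trPosNum, PosNum.ofWord]
    · rfl
  | cons a ls ih =>
    have := dec_iterate (n := Encodable.encode a) (j := 0) hU (by simpa using hα a) ih
    simpa [PosNum.ofWord] using this

/-- The configuration of the looping machine given by a configuration of the stack machine. -/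
def ofCfg : Cfg' → LoopState × (K' → List Γ')
  | ⟨some l, s, S⟩ => (run (tr l) s, S)
  | ⟨none, _, S⟩ => (dec 0, S)

variable {M : Finset Λ'}

theorem run_stepAux (hU : ∀ q s, some q ∈ TM2.stmts tr M → run q s ∈ U)
    {q : Statement} (hq : some q ∈ TM2.stmts tr M) {s : Option Γ'} {S : K' → List Γ'} {m : F}
    (h : MachineLoop entry letter U (ofCfg (TM2.stepAux q s S)) m) :
    MachineLoop entry letter U (run q s, S) m := by
  have key : ∀ (k : K') (L : List Γ'), L = S k → Function.update S k L = S := by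
    rintro k _ rfl
    exact Function.update_eq_self k S
  have hS : ∀ k, (S k).head?.toList ++ (S k).tail = S k := by
    intro k
    cases S k <;> rfl
  induction q generalizing s S with
  | push k f q ih =>
    refine of_act_one (hU _ _ hq) rfl ?_
    refine ih (TM2.stmts_trans (by simp [TM2.stmts₁, TM2.stmts₁_self]) hq) ?_ ?_ ?_
    · simpa [act, hS] using h
    · rintro k _ rfl
      exact Function.update_eq_self k _
    · intro k
      cases Function.update S _ _ k <;> rfl
  | peek k f q ih =>
    refine of_act_one (hU _ _ hq) rfl ?_
    rw [key _ _ (hS _)]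
    exact ih (TM2.stmts_trans (by simp [TM2.stmts₁, TM2.stmts₁_self]) hq) h key hS
  | pop k f q ih =>
    refine of_act_one (hU _ _ hq) rfl ?_
    refine ih (TM2.stmts_trans (by simp [TM2.stmts₁, TM2.stmts₁_self]) hq) ?_ ?_ ?_
    · simpa [act] using h
    · rintro k _ rfl
      exact Function.update_eq_self k _
    · intro k
      cases Function.update S _ _ k <;> rfl
  | load f q ih =>
    refine of_act_one (hU _ _ hq) rfl ?_
    rw [key _ _ (hS _)]
    exact ih (TM2.stmts_trans (by simp [TM2.stmts₁, TM2.stmts₁_self]) hq) h key hS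
  | branch p q₁ q₂ ih₁ ih₂ =>
    refine of_act_one (hU _ _ hq) rfl ?_
    rw [key _ _ (hS _)]
    rw [TM2.stepAux] at h
    cases hp : p s
    · rw [hp] at h
      exact ih₂ (TM2.stmts_trans (by simp [TM2.stmts₁, TM2.stmts₁_self]) hq) h key hS
    · rw [hp] at h
      exact ih₁ (TM2.stmts_trans (by simp [TM2.stmts₁, TM2.stmts₁_self]) hq) h key hS
  | goto l =>
    refine of_act_one (hU _ _ hq) rfl ?_
    rw [key _ _ (hS _)]
    exact h
  | halt =>
    refine of_act_one (hU _ _ hq) rfl ?_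
    rw [key _ _ (hS _)]
    exact h

theorem of_reaches [Inhabited Λ'] (hU : ∀ q s, some q ∈ TM2.stmts tr M → run q s ∈ U)
    (hM : TM2.Supports tr M) {x y : Cfg'} (hx : x.l ∈ Finset.insertNone M)
    (hxy : StateTransition.Reaches (TM2.step tr) x y) {m : F}
    (h : MachineLoop entry letter U (ofCfg y) m) : MachineLoop entry letter U (ofCfg x) m := by
  induction hxy using Relation.ReflTransGen.head_induction_on with
  | refl => exact h
  | head hstep _ ih =>
    specialize ih (TM2.step_supports tr hM hstep hx)
    rename_i a b _
    obtain ⟨_ | l, s, S⟩ := a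
    · cases hstep
    · cases hstep
      refine run_stepAux hU ?_ ih
      simp only [TM2.stmts, Finset.mem_insertNone, Finset.mem_biUnion, Option.mem_def,
        Option.some.injEq, forall_eq'] at hx ⊢
      rintro _ ⟨⟩
      exact ⟨l, hx, TM2.stmts₁_self⟩

end MachineLoop

/-- The binary number obtained by successively appending digits at the least significant end. -/
def appendDigits (T : List Γ') (p : PosNum) : PosNum :=
  T.foldl (fun p a => if a = .bit1 then p.bit1 else p.bit0) p

theorem exists_appendDigits (p : PosNum) :
    ∃ T : List Γ', (∀ a ∈ T, a = .bit0 ∨ a = .bit1) ∧ appendDigits T .one = p := by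
  induction p with
  | one => exact ⟨[], by simp, rfl⟩
  | bit1 p ih =>
    obtain ⟨T, hT, rfl⟩ := ih
    exact ⟨T ++ [.bit1], by simpa [or_imp, forall_and] using hT, by simp [appendDigits]⟩
  | bit0 p ih =>
    obtain ⟨T, hT, rfl⟩ := ih
    exact ⟨T ++ [.bit0], by simpa [or_imp, forall_and] using hT, by simp [appendDigits]⟩

namespace MachineLoop

variable {F : Type} [Group F] {entry : Statement} {letter : ℕ → F} {U : Set LoopState}

theorem copy (hU : copy ∈ U) (hput : ∀ a, put a ∈ U) (T : List Γ') {p : PosNum} {m : F}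
    (h : MachineLoop entry letter U
      (run entry none, K'.elim (trPosNum (appendDigits T p) ++ [.cons]) [] [] []) m) :
    MachineLoop entry letter U (copy, K'.elim (trPosNum p ++ [.cons]) [] T []) m := by
  induction T generalizing p with
  | nil =>
    refine of_act_one hU rfl ?_
    simpa [act, appendDigits] using h
  | cons a T ih =>
    refine of_act_one hU rfl (of_act_one (hput a) rfl ?_)
    have hne : ∀ L : List Γ', L.head?.toList ++ L.tail = L := by rintro (_ | _) <;> rfl
    have := ih (p := if a = .bit1 then p.bit1 else p.bit0) h
    convert this using 2
    simp only [act, K'.elim, K'.elim_update_aux, K'.elim_update_main, List.cons_append, hne,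
      List.tail_cons, List.nil_append]
    split_ifs <;> rfl

theorem start (hstart : start ∈ U) (hU : LoopState.copy ∈ U) (hput : ∀ a, put a ∈ U) (T : List Γ')
    {m : F} (h : MachineLoop entry letter U
      (run entry none, K'.elim (trPosNum (appendDigits T .one) ++ [.cons]) [] [] []) m) :
    MachineLoop entry letter U (start, K'.elim [] [] T []) m := by
  refine of_act_one hstart rfl ?_
  simpa [act, trPosNum] using copy hU hput T h

end MachineLoop

end Turing.PartrecToTM2

namespace Turing.PartrecToTM2

open LoopState

theorem MachineLoop.of_code {F : Type} [Group F] {letter : ℕ → F} {U : Set LoopState}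
    {α : Type} [Encodable α] {J : ℕ} {c : ToPartrec.Code} {n : ℕ} {ls : List α}
    (hrun : ∀ q s, some q ∈ TM2.stmts tr (codeSupp c Cont'.halt) → run q s ∈ U)
    (hdec : ∀ j ≤ J, dec j ∈ U) (hJ : 1 ≤ J) (hα : ∀ a : α, Encodable.encode a ≤ J)
    (hc : c.eval [n] = Part.some [(PosNum.ofWord ls : ℕ)]) :
    MachineLoop (tr (trNormal c Cont'.halt)) letter U
      (run (tr (trNormal c Cont'.halt)) none, K'.elim (trNat n ++ [.cons]) [] [] [])
      (ls.map fun a => letter (Encodable.encode a)).prod := by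
  have hmem : halt [(PosNum.ofWord ls : ℕ)] ∈ StateTransition.eval (TM2.step tr) (init c [n]) := by
    rw [tr_eval, hc]
    exact Part.mem_map _ (Part.mem_some _)
  let _ : Inhabited Λ' := ⟨trNormal c Cont'.halt⟩
  have hM : TM2.Supports tr (codeSupp c Cont'.halt) := tr_supports c Cont'.halt
  have := of_reaches (entry := tr (trNormal c Cont'.halt)) (letter := letter)
    (m := (ls.map fun a => letter (Encodable.encode a)).prod) hrun hM
    (Finset.some_mem_insertNone.2 hM.1) (StateTransition.mem_eval.1 hmem).1
    (by simpa [halt, ofCfg, trNat_posNum] using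
      dec_ofWord (entry := tr (trNormal c Cont'.halt)) hdec hJ hα ls)
  simpa [ofCfg, init] using this

end Turing.PartrecToTM2

open Turing Turing.PartrecToTM2 LoopState in
theorem exists_isBenign_of_computable {k : ℕ} {f : ℕ → FreeGroup (Fin k)}
    (hf : Computable fun n => (f n).toWord) :
    ∃ E : Set (FreeGroup (Fin k)), Set.range f ⊆ E ∧ E ⊆ Subgroup.closure (Set.range f) ∧
      IsBenign E := by
  obtain ⟨c, hc⟩ := exists_code_ofWord hf
  let entry := tr (trNormal c Cont'.halt)
  let letter : ℕ → FreeGroup (Fin k) := fun j =>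
    ((Encodable.decode j : Option (Fin k × Bool)).map fun a => FreeGroup.mk [a]).getD 1
  obtain ⟨J, hJ⟩ := (Set.finite_range (Encodable.encode : Fin k × Bool → ℕ)).bddAbove
  let U : Set LoopState := {start, copy} ∪ Set.range put ∪
    (fun x : Statement × Option Γ' => run x.1 x.2) ''
      ((some ⁻¹' (TM2.stmts tr (codeSupp c Cont'.halt) : Set (Option Statement))) ×ˢ Set.univ) ∪
    dec '' Set.Iic (J + 1)
  have hU : U.Finite := by
    refine (((Set.toFinite _).union (Set.finite_range _)).union (Set.Finite.image _
      (Set.Finite.prod ?_ Set.finite_univ))).union ((Set.finite_Iic _).image _)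
    exact (Finset.finite_toSet _).preimage (Option.some_injective _).injOn
  have hrun : ∀ q s, some q ∈ TM2.stmts tr (codeSupp c Cont'.halt) → run q s ∈ U :=
    fun q s hq => Or.inl (Or.inr ⟨(q, s), ⟨hq, trivial⟩, rfl⟩)
  have hdec : ∀ j ≤ J + 1, dec j ∈ U := fun j hj => Or.inr ⟨j, hj, rfl⟩
  have hword : ∀ n, ((f n).toWord.map fun a => letter (Encodable.encode a)).prod = f n := by
    intro n
    conv_rhs => rw [← FreeGroup.mk_toWord (x := f n)]
    induction (f n).toWord with
    | nil => rfl
    | cons a l ih =>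
      rw [List.map_cons, List.prod_cons, ih]
      simp only [letter, Encodable.encodek]
      exact FreeGroup.mul_mk
  have hloop : ∀ (T : List Γ') (n : ℕ), (appendDigits T .one : ℕ) = n + 1 →
      MachineLoop entry letter U (start, K'.elim [] [] T []) (f n) := by
    intro T n hn
    refine MachineLoop.start (by simp [U]) (by simp [U]) (by simp [U]) T ?_
    have := MachineLoop.of_code (letter := letter) (J := J + 1) hrun hdec (by omega)
      (fun a => (hJ ⟨a, rfl⟩).trans (Nat.le_succ _)) (hc n)
    rwa [hword, ← hn, trNat_posNum] at this
  have := (finite_loopRules entry letter hU).to_subtype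
  have hE := isBenign_prefixRules (noTorsion_of_isMulTorsionFree (FreeGroup (Fin k)))
    (fun r : loopRules entry letter U => r.1) build
  have hedge : ∀ x y : (LoopState × (K' → List Γ')) × FreeGroup (Fin k),
      (∃ r : loopRules entry letter U, r.1.Applies x y) ↔
        LoopEdge entry letter U x.1 (x.2⁻¹ * y.2) y.1 := by
    intro x y
    simp only [PrefixRule.applies_iff, LoopEdge, Subtype.exists, exists_prop]
  simp only [hedge] at hE
  refine ⟨_, ?_, fun w hw => ?_, hE⟩
  · rintro _ ⟨n, rfl⟩
    obtain ⟨p, hp⟩ := PosNum.exists_cast_eq_succ n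
    obtain ⟨T, hT, rfl⟩ := exists_appendDigits p
    have hbuild : Relation.EqvGen
        (fun x y : (LoopState × (K' → List Γ')) × FreeGroup (Fin k) =>
          LoopEdge entry letter U x.1 (x.2⁻¹ * y.2) y.1)
        ((build, fun _ => []), 1) ((build, K'.elim [] [] T []), 1) := by
      clear hp
      induction T with
      | nil =>
        convert Relation.EqvGen.refl _ using 3
        funext j
        cases j <;> rfl
      | cons a T ih =>
        refine .trans _ _ _ (ih fun b hb => hT b (List.mem_cons_of_mem _ hb)) (.rel _ _
          ⟨pushRule a, Or.inr ?_, ⟨K'.elim [] [] T [], fun j hj => absurd trivial hj, ?_, ?_⟩,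
            by simp [pushRule]⟩)
        · rcases hT a List.mem_cons_self with rfl | rfl <;> simp
        · rfl
        · refine Prod.ext rfl (funext fun j => ?_)
          cases j <;> rfl
    refine .trans _ _ _ hbuild (.trans _ ((start, K'.elim [] [] T []), 1) _ (.rel _ _
      ⟨startRule, Or.inr (by simp), ⟨K'.elim [] [] T [], ?_, rfl, rfl⟩, by simp [startRule]⟩) ?_)
    · intro j hj
      cases j <;> first | rfl | exact absurd rfl hj
    · simpa using (hloop T n hp).eqvGen 1
  · refine LoopLabel.mem_of_eqvGen (edge := LoopEdge entry letter U)
      (isBase := fun x => x.1 = build) rfl (fun x y y' l l' hx h h' => h.det hx h') ?_ ?_ ?_ hw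
    · intro x l y hx h
      rcases h.cases with ⟨-, -, h⟩ | ⟨T, -, -, h⟩ | ⟨-, -, h⟩ | ⟨out, q, hact, -⟩
      · exact h
      · exact h
      · exact h
      · simp [hx, act] at hact
    · intro x l y hx hy h
      rcases h.cases with ⟨h, -⟩ | ⟨T, rfl, -⟩ | ⟨-, h, -⟩ | ⟨out, q, hact, rfl⟩
      · exact absurd h hx
      · exact absurd rfl hx
      · exact h
      · obtain rfl : q = build := hy
        exact absurd hact (act_ne_build _ _)
    · intro x l y hx hy h
      rcases h.cases with ⟨-, h, -⟩ | ⟨T, -, rfl, -⟩ | ⟨-, rfl, -⟩ | ⟨out, q, hact, -⟩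
      · exact absurd h hy
      · obtain ⟨n, hn⟩ : ∃ n, (appendDigits T .one : ℕ) = n + 1 :=
          ⟨_, (Nat.succ_pred_eq_of_pos (PosNum.cast_pos _)).symm⟩
        exact ⟨f n, Subgroup.subset_closure ⟨n, rfl⟩, hloop T n hn⟩
      · exact absurd rfl hy
      · simp [hx, act] at hact

/-- Theorem (the Higman embedding preserves torsion length): every finitely generated
recursively presented group `C` embeds into a finitely presented group `H` whose torsion
chain stabilises at exactly the same stages: for all `m`,
`tor_m(C) = tor_{m+1}(C) ↔ tor_m(H) = tor_{m+1}(H)`. -/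
theorem higman_embedding_torlen (k : ℕ) (R : Set (FreeGroup (Fin k)))
    (hR : ∃ f : ℕ → FreeGroup (Fin k), R = Set.range f ∧
      Computable fun n => (f n).toWord) :
    ∃ (j : ℕ) (S : Finset (FreeGroup (Fin j)))
      (ι : PresentedGroup R →* PresentedGroup (S : Set (FreeGroup (Fin j)))),
      Function.Injective ι ∧
      ∀ m : ℕ,
        (tor (PresentedGroup R) m = tor (PresentedGroup R) (m + 1) ↔
          tor (PresentedGroup (S : Set (FreeGroup (Fin j)))) m =
            tor (PresentedGroup (S : Set (FreeGroup (Fin j)))) (m + 1)) := by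
  obtain ⟨f, rfl, hf⟩ := hR
  obtain ⟨E, hfE, hEf, hE⟩ := exists_isBenign_of_computable hf
  obtain ⟨H, _, ι, hH, hι, htor⟩ := hE.exists_finitelyPresented hfE hEf
  obtain ⟨j, s, hs, ⟨e⟩⟩ := Group.IsFinitelyPresented.exists_mulEquiv_presentedGroup (G := H)
  obtain ⟨S, rfl⟩ := hs.exists_finset_coe
  exact ⟨j, S, e.toMonoidHom.comp ι, e.injective.comp hι,
    fun m => (htor m).trans (tor_eq_succ_iff_of_mulEquiv e m)⟩
end

section
/- There exists a finitely presented group F with torsion length ω; that is, there exist k ∈ ℕ and a finite set R ⊆ FreeGroup(Fin k) such that the group F = PresentedGroup R satisfies tor_m(F) ⊊ tor_{m+1}(F) for every m ∈ ℕ. -/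
open scoped commutatorElement

theorem tor_normal_s7 (G : Type*) [Group G] : ∀ n, (tor G n).Normal
  | 0 => inferInstanceAs (⊥ : Subgroup G).Normal
  | _ + 1 => Subgroup.normalClosure_normal

/-- If every element of finite order of `W` dies under `τ`, then `n` applications of `τ` kill the
image in `W` of the `n`-th term of the torsion chain. -/
theorem iterate_eq_one_of_mem_tor {G W : Type*} [Group G] [Group W] (τ : Monoid.End W)
    (hτ : ∀ w : W, IsOfFinOrder w → τ w = 1) (f : G →* W) (n : ℕ) :
    ∀ g ∈ tor G n, τ^[n] (f g) = 1 := by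
  induction n with
  | zero =>
    intro g hg
    obtain rfl : g = 1 := hg
    simp
  | succ n ih =>
    have hcoe (g : G) : MonoidHom.comp (τ ^ (n + 1)) f g = τ^[n + 1] (f g) :=
      congrFun (Monoid.End.coe_pow W τ (n + 1)) (f g)
    have key : tor G (n + 1) ≤ (MonoidHom.comp (τ ^ (n + 1)) f).ker := by
      refine Subgroup.normalClosure_le_normal ?_
      rintro g ⟨k, hk, hg⟩
      have h := ih _ hg
      rw [map_pow, iterate_map_pow] at h
      have := hτ _ (isOfFinOrder_iff_pow_eq_one.2 ⟨k, hk, h⟩)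
      exact (hcoe g).trans ((Function.iterate_succ_apply' _ _ _).trans this)
    exact fun g hg => (hcoe g).symm.trans (key hg)

/-- The commutator of `x` with the `m`-th translate of `y` under `a`. -/
def shiftComm {G : Type*} [Group G] (x y a : G) (m : ℕ) : G := ⁅x, a ^ m * y * (a ^ m)⁻¹⁆

theorem map_shiftComm {G H F : Type*} [Group G] [Group H] [FunLike F G H] [MonoidHomClass F G H]
    (f : F) (x y a : G) (m : ℕ) :
    f (shiftComm x y a m) = shiftComm (f x) (f y) (f a) m := by
  simp [shiftComm, map_commutatorElement]

/-- The relator expressing that `p` inverts `q ^ 2`. -/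
def invRel {G : Type*} [Group G] (p q : G) : G := p * q ^ 2 * p⁻¹ * q ^ 2

theorem map_invRel {G H F : Type*} [Group G] [Group H] [FunLike F G H] [MonoidHomClass F G H]
    (f : F) (p q : G) : f (invRel p q) = invRel (f p) (f q) := by
  simp [invRel]

/-- The relator `invRel` is propagated along the translates by an element shifting `y`. -/
theorem invRel_shiftComm {G : Type*} [Group G] {x y a s : G} (hx : s * x = x * s)
    (ha : s * a = a * s) (hy : s * y * s⁻¹ = a * y * a⁻¹)
    (h : invRel (shiftComm x y a 0) (shiftComm x y a 1) = 1) (m : ℕ) :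
    invRel (shiftComm x y a m) (shiftComm x y a (m + 1)) = 1 := by
  have hx' : MulAut.conj s x = x := by simp [hx]
  have ha' : MulAut.conj s a = a := by simp [ha]
  have step : ∀ k, MulAut.conj s (shiftComm x y a k) = shiftComm x y a (k + 1) := by
    intro k
    rw [map_shiftComm, hx', ha', MulAut.conj_apply, hy]
    simp only [shiftComm, pow_succ]
    group
  induction m with
  | zero => exact h
  | succ m ih =>
    have := congrArg (MulAut.conj s) ih
    rwa [map_invRel, step, step, map_one] at this

/-- If `c` conjugates each of `x`, `y`, `a` to its product with an element of the commuting family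
`x'`, `y'`, `a'`, then every relation between the former holds between the latter. -/
theorem lift_eq_one_of_conj {ι G : Type*} [Group G] (u v : ι → G) (c : G)
    (huv : ∀ i j, Commute (u i) (v j)) (hc : ∀ i, c * u i * c⁻¹ = u i * v i) (w : FreeGroup ι)
    (hw : FreeGroup.lift u w = 1) : FreeGroup.lift v w = 1 := by
  have h1 : ∀ i (q : FreeGroup ι), Commute (u i) (FreeGroup.lift v q) := by
    intro i q
    induction q using FreeGroup.induction_on with
    | C1 => simp
    | of j => simpa using huv i j
    | inv_of j h => simpa using h.inv_right
    | mul p q hp hq => simpa using hp.mul_right hq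
  have h2 : ∀ p q : FreeGroup ι, Commute (FreeGroup.lift u p) (FreeGroup.lift v q) := by
    intro p q
    induction p using FreeGroup.induction_on with
    | C1 => simp
    | of j => simpa using h1 j q
    | inv_of j h => simpa using h.inv_left
    | mul p q hp hq => simpa using hp.mul_left hq
  have key : (MulAut.conj c).toMonoidHom.comp (FreeGroup.lift u) =
      (MonoidHom.noncommCoprod (FreeGroup.lift u) (FreeGroup.lift v) h2).comp
        ((MonoidHom.id _).prod (MonoidHom.id _)) := by
    ext i
    simp [hc]
  have := DFunLike.congr_fun key w
  simpa [hw] using this.symm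

/-- The relations, on generators `x`, `y`, `a`, `s`, `c`, of the group of torsion length `ω`. -/
structure TorsionTower {G : Type*} [Group G] (x y a s c : G) : Prop where
  comm_x : ⁅s, x⁆ = 1
  comm_a : ⁅s, a⁆ = 1
  shift : s * y * s⁻¹ * (a * y * a⁻¹)⁻¹ = 1
  inv : invRel (shiftComm x y a 0) (shiftComm x y a 1) = 1
  comm : ∀ i j : Fin 3, ⁅![x, y, a] i, ⁅(![x, y, a] j)⁻¹, c⁆⁆ = 1
  seed : shiftComm ⁅x⁻¹, c⁆ ⁅y⁻¹, c⁆ ⁅a⁻¹, c⁆ 0 = 1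

theorem TorsionTower.shiftComm_mem_tor {G : Type*} [Group G] {x y a s c : G}
    (h : TorsionTower x y a s c) (m : ℕ) :
    shiftComm ⁅x⁻¹, c⁆ ⁅y⁻¹, c⁆ ⁅a⁻¹, c⁆ m ∈ tor G m := by
  have rel : ∀ m, invRel (shiftComm ⁅x⁻¹, c⁆ ⁅y⁻¹, c⁆ ⁅a⁻¹, c⁆ m)
      (shiftComm ⁅x⁻¹, c⁆ ⁅y⁻¹, c⁆ ⁅a⁻¹, c⁆ (m + 1)) = 1 := by
    intro m
    have h1 := invRel_shiftComm (commutatorElement_eq_one_iff_mul_comm.1 h.comm_x)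
      (commutatorElement_eq_one_iff_mul_comm.1 h.comm_a) (mul_inv_eq_one.1 h.shift) h.inv m
    have h2 := lift_eq_one_of_conj ![x, y, a] (fun i => ⁅(![x, y, a] i)⁻¹, c⁆) c
      (fun i j => commutatorElement_eq_one_iff_mul_comm.1 (h.comm i j))
      (fun i => by simp only [commutatorElement_def]; group)
      (invRel
        (shiftComm (FreeGroup.of (0 : Fin 3)) (FreeGroup.of 1) (FreeGroup.of 2) m)
        (shiftComm (FreeGroup.of (0 : Fin 3)) (FreeGroup.of 1) (FreeGroup.of 2) (m + 1)))
    simp only [map_invRel, map_shiftComm, FreeGroup.lift_apply_of] at h2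
    exact h2 h1
  induction m with
  | zero => exact h.seed
  | succ m ih =>
    refine Subgroup.subset_normalClosure ⟨4, by norm_num, ?_⟩
    have := tor_normal_s7 G m
    have hm := rel m
    set p := shiftComm ⁅x⁻¹, c⁆ ⁅y⁻¹, c⁆ ⁅a⁻¹, c⁆ m
    set q := shiftComm ⁅x⁻¹, c⁆ ⁅y⁻¹, c⁆ ⁅a⁻¹, c⁆ (m + 1)
    have hq : q ^ 4 = p⁻¹ * (q⁻¹ ^ 2 * p * (q⁻¹ ^ 2)⁻¹) := by
      have h3 : p * q ^ 2 * p⁻¹ = (q ^ 2)⁻¹ := eq_inv_of_mul_eq_one_left hm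
      have h4 : p⁻¹ * (q ^ 2)⁻¹ * p = q ^ 2 := by rw [← h3]; group
      calc q ^ 4 = q ^ 2 * q ^ 2 := by group
        _ = p⁻¹ * (q ^ 2)⁻¹ * p * q ^ 2 := by rw [h4]
        _ = _ := by group
    rw [hq]
    exact mul_mem (inv_mem ih) (this.conj_mem _ ih _)

/-- The relators of `TorsionTower`, as words in five letters. -/
def towerRelators : Finset (FreeGroup (Fin 5)) :=
  let x := FreeGroup.of 0
  let y := FreeGroup.of 1
  let a := FreeGroup.of 2
  let s := FreeGroup.of 3
  let c := FreeGroup.of 4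
  {⁅s, x⁆, ⁅s, a⁆, s * y * s⁻¹ * (a * y * a⁻¹)⁻¹,
    invRel (shiftComm x y a 0) (shiftComm x y a 1),
    shiftComm ⁅x⁻¹, c⁆ ⁅y⁻¹, c⁆ ⁅a⁻¹, c⁆ 0} ∪
  Finset.univ.image fun p : Fin 3 × Fin 3 => ⁅![x, y, a] p.1, ⁅(![x, y, a] p.2)⁻¹, c⁆⁆

theorem forall_towerRelators_iff {G : Type*} [Group G] (φ : FreeGroup (Fin 5) →* G) :
    (∀ r ∈ towerRelators, φ r = 1) ↔
      TorsionTower (φ (.of 0)) (φ (.of 1)) (φ (.of 2)) (φ (.of 3)) (φ (.of 4)) := by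
  have hv : ∀ i, φ (![FreeGroup.of 0, FreeGroup.of 1, FreeGroup.of 2] i) =
      ![φ (.of 0), φ (.of 1), φ (.of 2)] i := by
    intro i; fin_cases i <;> rfl
  simp only [towerRelators, Finset.mem_union, Finset.mem_insert, Finset.mem_singleton,
    Finset.mem_image, Finset.mem_univ, true_and, or_imp, forall_and, forall_eq,
    forall_exists_index, Prod.forall, map_commutatorElement, map_mul, map_inv, map_invRel,
    map_shiftComm]
  constructor
  · rintro ⟨⟨h1, h2, h3, h4, h5⟩, h6⟩
    exact ⟨h1, h2, h3, h4,
      fun i j => by simpa only [map_commutatorElement, map_inv, hv] using h6 _ i j rfl, h5⟩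
  · rintro ⟨h1, h2, h3, h4, h6, h5⟩
    refine ⟨⟨h1, h2, h3, h4, h5⟩, ?_⟩
    rintro _ i j rfl
    simpa only [map_commutatorElement, map_inv, hv] using h6 i j

theorem tor_lt_tor_succ_of_torsionTower {W : Type*} [Group W] {x y a s c : W}
    (h : TorsionTower x y a s c) (τ : Monoid.End W) (hτ : ∀ w : W, IsOfFinOrder w → τ w = 1)
    (hne : ∀ m, τ^[m] (shiftComm ⁅x⁻¹, c⁆ ⁅y⁻¹, c⁆ ⁅a⁻¹, c⁆ (m + 1)) ≠ 1) (m : ℕ) :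
    tor (PresentedGroup (towerRelators : Set (FreeGroup (Fin 5)))) m <
      tor (PresentedGroup (towerRelators : Set (FreeGroup (Fin 5)))) (m + 1) := by
  have hG := (forall_towerRelators_iff
    (PresentedGroup.mk (towerRelators : Set (FreeGroup (Fin 5))))).1
    fun r hr => PresentedGroup.one_of_mem hr
  have hf : ∀ r ∈ (towerRelators : Set (FreeGroup (Fin 5))),
      FreeGroup.lift ![x, y, a, s, c] r = 1 := by
    refine (forall_towerRelators_iff _).2 ?_
    simpa using h
  let f := PresentedGroup.toGroup hf
  have hmem := hG.shiftComm_mem_tor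
  refine lt_of_le_not_ge (fun g hg => Subgroup.subset_normalClosure ⟨1, one_pos, by simpa⟩)
    fun hle => hne m ?_
  have := iterate_eq_one_of_mem_tor τ hτ f m _ (hle (hmem (m + 1)))
  have hof (i : Fin 5) : f (PresentedGroup.mk _ (.of i)) = ![x, y, a, s, c] i :=
    PresentedGroup.toGroup.of hf
  simp only [map_shiftComm, map_commutatorElement, map_inv, hof] at this
  exact this

/-- Elements of finite order in a semidirect product with torsion-free right factor. -/
theorem right_eq_one_and_isOfFinOrder_left {N H : Type*} [Group N] [Group H] {φ : H →* MulAut N}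
    (hH : ∀ h : H, IsOfFinOrder h → h = 1) {w : N ⋊[φ] H} (hw : IsOfFinOrder w) :
    w.right = 1 ∧ IsOfFinOrder w.left := by
  have h1 : w.right = 1 := hH _ (SemidirectProduct.rightHom.isOfFinOrder hw)
  have h2 : w = SemidirectProduct.inl w.left := SemidirectProduct.ext rfl h1
  rw [h2] at hw
  exact ⟨h1, (SemidirectProduct.inl_injective.isOfFinOrder_iff (f := SemidirectProduct.inl)).1 hw⟩

theorem isOfFinOrder_apply {Ω N : Type*} [Group N] {f : Ω → N} (hf : IsOfFinOrder f) (ω : Ω) :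
    IsOfFinOrder (f ω) :=
  (Pi.evalMonoidHom _ ω).isOfFinOrder hf

/-- Permutational wreath products of torsion-free groups are torsion-free. -/
theorem eq_one_of_isOfFinOrder_wreath {Ω N H : Type*} [Group N] [Group H]
    {φ : H →* MulAut (Ω → N)} (hN : ∀ n : N, IsOfFinOrder n → n = 1)
    (hH : ∀ h : H, IsOfFinOrder h → h = 1) (w : (Ω → N) ⋊[φ] H) (hw : IsOfFinOrder w) : w = 1 := by
  obtain ⟨h1, h2⟩ := right_eq_one_and_isOfFinOrder_left hH hw
  exact SemidirectProduct.ext (funext fun ω => hN _ (isOfFinOrder_apply h2 ω)) h1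

section Wreath

/-- The action of a group `H` acting on `Ω` on the functions `Ω → N`. -/
def arrowAut (H Ω N : Type*) [Group H] [MulAction H Ω] [Group N] : H →* MulAut (Ω → N) :=
  mulAutArrow

@[simp]
theorem arrowAut_apply {H Ω N : Type*} [Group H] [MulAction H Ω] [Group N] (h : H) (f : Ω → N)
    (ω : Ω) : arrowAut H Ω N h f ω = f (h⁻¹ • ω) := rfl

@[simp]
theorem arrowAut_symm_apply {H Ω N : Type*} [Group H] [MulAction H Ω] [Group N] (h : H)
    (f : Ω → N) (ω : Ω) : (arrowAut H Ω N h).symm f ω = f (h • ω) := by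
  obtain ⟨g, rfl⟩ := (arrowAut H Ω N h).surjective f
  simp

/-- The unrestricted regular wreath product. -/
abbrev Wreath (K P : Type*) [Group K] [Group P] : Type _ := (K → P) ⋊[arrowAut K K P] K

variable {K P : Type*} [Group K] [Group P]

/-- The constant function with value `p`, in the regular wreath product. -/
def wreathConst (K : Type*) {P : Type*} [Group K] [Group P] : P →* Wreath K P :=
  SemidirectProduct.inl.comp (Pi.constMonoidHom K P)

/-- The endomorphism of the regular wreath product induced by an endomorphism of the base. -/
def wreathEnd (K : Type*) {P : Type*} [Group K] [Group P] (τ : Monoid.End P) :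
    Monoid.End (Wreath K P) :=
  SemidirectProduct.map (MonoidHom.compLeft τ K) (MonoidHom.id K) fun _ => rfl

theorem iterate_wreathEnd_wreathConst (τ : Monoid.End P) (m : ℕ) (p : P) :
    (wreathEnd K τ)^[m] (wreathConst K p) = wreathConst K (τ^[m] p) :=
  ((Function.Semiconj.iterate_right (f := wreathConst K) (ga := τ) (gb := wreathEnd K τ)
    (fun _ => rfl) m) p).symm

theorem wreathConst_injective : Function.Injective (wreathConst K : P →* Wreath K P) :=
  fun _ _ h => congrFun (SemidirectProduct.inl_injective h) 1

theorem wreathEnd_eq_one (hK : ∀ k : K, IsOfFinOrder k → k = 1) {τ : Monoid.End P}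
    (hτ : ∀ p : P, IsOfFinOrder p → τ p = 1) (w : Wreath K P) (hw : IsOfFinOrder w) :
    wreathEnd K τ w = 1 := by
  obtain ⟨h1, h2⟩ := right_eq_one_and_isOfFinOrder_left hK hw
  exact SemidirectProduct.ext (funext fun k => hτ _ (isOfFinOrder_apply h2 k)) h1

/-- If `γ : K → P` intertwines multiplication by `k` with multiplication by `p`, then conjugation
by `γ` multiplies `k` by the constant function `p`. -/
theorem commutator_inl_eq_wreathConst (γ : K → P) (k : K) (p : P)
    (h : ∀ j, γ (k * j) = p * γ j) :
    ⁅(SemidirectProduct.inr k : Wreath K P)⁻¹, (SemidirectProduct.inl γ : Wreath K P)⁆ =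
      wreathConst K p := by
  rw [commutatorElement_def]
  refine SemidirectProduct.ext (funext fun j => ?_) ?_
  · simp [wreathConst, h]
  · simp [wreathConst]

theorem commutator_inr_wreathConst (k : K) (p : P) :
    ⁅(SemidirectProduct.inr k : Wreath K P), wreathConst K p⁆ = 1 := by
  rw [commutatorElement_def]
  refine SemidirectProduct.ext (funext fun j => ?_) ?_
  · simp [wreathConst]
  · simp [wreathConst]

theorem torsionTower_wreath {x y a s : K} {x' y' a' : P} (γ : K → P)
    (hsx : ⁅s, x⁆ = 1) (hsa : ⁅s, a⁆ = 1) (hsy : s * y * s⁻¹ * (a * y * a⁻¹)⁻¹ = 1)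
    (hinv : invRel (shiftComm x y a 0) (shiftComm x y a 1) = 1)
    (hx : ∀ j, γ (x * j) = x' * γ j) (hy : ∀ j, γ (y * j) = y' * γ j)
    (ha : ∀ j, γ (a * j) = a' * γ j) (hseed : shiftComm x' y' a' 0 = 1) :
    TorsionTower (SemidirectProduct.inr x : Wreath K P) (SemidirectProduct.inr y : Wreath K P)
      (SemidirectProduct.inr a : Wreath K P) (SemidirectProduct.inr s : Wreath K P)
      (SemidirectProduct.inl γ : Wreath K P) where
  comm_x := by rw [← map_commutatorElement, hsx, map_one]
  comm_a := by rw [← map_commutatorElement, hsa, map_one]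
  shift := by simp only [← map_mul, ← map_inv, hsy, map_one]
  inv := by rw [← map_shiftComm, ← map_shiftComm, ← map_invRel, hinv, map_one]
  comm i j := by
    have hi : ![(SemidirectProduct.inr x : Wreath K P), SemidirectProduct.inr y,
        SemidirectProduct.inr a] i = SemidirectProduct.inr (![x, y, a] i) := by
      fin_cases i <;> rfl
    have hj : ⁅(![(SemidirectProduct.inr x : Wreath K P), SemidirectProduct.inr y,
        SemidirectProduct.inr a] j)⁻¹, (SemidirectProduct.inl γ : Wreath K P)⁆ =
          wreathConst K (![x', y', a'] j) := by
      fin_cases j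
      exacts [commutator_inl_eq_wreathConst γ x x' hx, commutator_inl_eq_wreathConst γ y y' hy,
        commutator_inl_eq_wreathConst γ a a' ha]
    rw [hi, hj, commutator_inr_wreathConst]
  seed := by
    rw [commutator_inl_eq_wreathConst γ x x' hx, commutator_inl_eq_wreathConst γ y y' hy,
      commutator_inl_eq_wreathConst γ a a' ha, ← map_shiftComm, hseed, map_one]

/-- A sufficient condition for the torsion chain of the group with relators `towerRelators` to be
strictly increasing. -/
theorem tor_lt_tor_succ_of_wreath {x y a s : K} {x' y' a' : P} (γ : K → P)
    (hsx : ⁅s, x⁆ = 1) (hsa : ⁅s, a⁆ = 1) (hsy : s * y * s⁻¹ * (a * y * a⁻¹)⁻¹ = 1)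
    (hinv : invRel (shiftComm x y a 0) (shiftComm x y a 1) = 1)
    (hx : ∀ j, γ (x * j) = x' * γ j) (hy : ∀ j, γ (y * j) = y' * γ j)
    (ha : ∀ j, γ (a * j) = a' * γ j) (hseed : shiftComm x' y' a' 0 = 1)
    (hK : ∀ k : K, IsOfFinOrder k → k = 1) {τ : Monoid.End P}
    (hτ : ∀ p : P, IsOfFinOrder p → τ p = 1)
    (hne : ∀ m, τ^[m] (shiftComm x' y' a' (m + 1)) ≠ 1) (m : ℕ) :
    tor (PresentedGroup (towerRelators : Set (FreeGroup (Fin 5)))) m <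
      tor (PresentedGroup (towerRelators : Set (FreeGroup (Fin 5)))) (m + 1) := by
  refine tor_lt_tor_succ_of_torsionTower
    (torsionTower_wreath γ hsx hsa hsy hinv hx hy ha hseed) (wreathEnd K τ)
    (wreathEnd_eq_one hK hτ) (fun m h => hne m ?_) m
  rw [commutator_inl_eq_wreathConst γ x x' hx, commutator_inl_eq_wreathConst γ y y' hy,
    commutator_inl_eq_wreathConst γ a a' ha, ← map_shiftComm, iterate_wreathEnd_wreathConst] at h
  exact wreathConst_injective (h.trans (map_one _).symm)

end Wreath

open DihedralGroup in
/-- The sign of a rotation or reflection of `ℤ` according to the parity of its parameter. -/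
def dihedralParity : DihedralGroup 0 →* ℤˣ where
  toFun
    | r i => Int.negOnePow i
    | sr i => Int.negOnePow i
  map_one' := Int.negOnePow_zero
  map_mul' := by
    rintro (i | i) (j | j)
    · exact Int.negOnePow_add i j
    · exact (Int.negOnePow_sub j i).trans (mul_comm _ _)
    · exact Int.negOnePow_add i j
    · exact (Int.negOnePow_sub j i).trans (mul_comm _ _)

open DihedralGroup in
/-- The sign distinguishing rotations from reflections. -/
def dihedralSign : DihedralGroup 0 →* ℤˣ where
  toFun
    | r _ => 1
    | sr _ => -1
  map_one' := rfl
  map_mul' := by rintro (i | i) (j | j) <;> rfl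

theorem eq_one_of_isOfFinOrder_of_dihedralSign {d : DihedralGroup 0} (hd : IsOfFinOrder d)
    (h : dihedralSign d = 1) : d = 1 := by
  obtain i | i := d
  · obtain ⟨n, hn, h⟩ := isOfFinOrder_iff_pow_eq_one.1 hd
    rw [DihedralGroup.r_pow, DihedralGroup.one_def, DihedralGroup.r.injEq] at h
    have h' : (i : ℤ) * n = 0 := by exact_mod_cast h
    obtain hi | hi := mul_eq_zero.1 h'
    · exact congrArg DihedralGroup.r hi
    · exact absurd (Int.natCast_eq_zero.1 hi) hn.ne'
  · exact absurd (show (-1 : ℤˣ) = 1 from h) (by decide)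

/-- The sequences of pairs of elements of the infinite dihedral group in which the signs of each
term are prescribed by the parities of the previous one. -/
def coherentSeq (I : Type*) [Add I] [One I] :
    Subgroup (I → DihedralGroup 0 × DihedralGroup 0) where
  carrier := {p | ∀ i, dihedralParity (p i).1 = dihedralSign (p (i + 1)).1 ∧
    dihedralParity (p i).2 = dihedralSign (p (i + 1)).1 ∧
    dihedralSign (p i).1 * dihedralSign (p i).2 = dihedralSign (p (i + 1)).1}
  one_mem' := by simp
  mul_mem' {p q} hp hq i := by
    obtain ⟨h1, h2, h3⟩ := hp i
    obtain ⟨h4, h5, h6⟩ := hq i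
    simp only [Pi.mul_apply, Prod.fst_mul, Prod.snd_mul, map_mul]
    refine ⟨by rw [h1, h4], by rw [h2, h5], ?_⟩
    rw [← h3, ← h6]
    exact mul_mul_mul_comm _ _ _ _
  inv_mem' {p} hp i := by
    obtain ⟨h1, h2, h3⟩ := hp i
    simp only [Pi.inv_apply, Prod.fst_inv, Prod.snd_inv, map_inv]
    exact ⟨by rw [h1], by rw [h2], by rw [← h3, mul_inv]⟩

/-- Reindexing of coherent sequences along a map commuting with successors. -/
def coherentSeq.reindex {I J : Type*} [Add I] [One I] [Add J] [One J] (e : I → J)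
    (he : ∀ i, e (i + 1) = e i + 1) : coherentSeq J →* coherentSeq I where
  toFun p := ⟨fun i => p.1 (e i), fun i => by simpa only [he] using p.2 (e i)⟩
  map_one' := rfl
  map_mul' _ _ := rfl

/-- A coherent sequence of finite order is trivial except possibly at its initial term. -/
theorem coherentSeq_apply_eq_one {I : Type*} [Add I] [One I] {p : coherentSeq I}
    (hp : IsOfFinOrder p) (i : I) : p.1 (i + 1) = 1 := by
  have hfin : ∀ i, IsOfFinOrder (p.1 i) :=
    isOfFinOrder_apply ((coherentSeq I).subtype.isOfFinOrder hp)
  have hfst : ∀ i, IsOfFinOrder (p.1 i).1 := fun i => (MonoidHom.fst _ _).isOfFinOrder (hfin i)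
  have hsnd : ∀ i, IsOfFinOrder (p.1 i).2 := fun i => (MonoidHom.snd _ _).isOfFinOrder (hfin i)
  have hsign : ∀ i, dihedralSign (p.1 (i + 1)).1 = 1 := by
    intro i
    obtain ⟨h1, h2, h3⟩ := p.2 i
    by_cases h : dihedralSign (p.1 i).1 = 1
    · rw [← h1, eq_one_of_isOfFinOrder_of_dihedralSign (hfst i) h, map_one]
    by_cases h' : dihedralSign (p.1 i).2 = 1
    · rw [← h2, eq_one_of_isOfFinOrder_of_dihedralSign (hsnd i) h', map_one]
    rw [← h3, Int.units_ne_iff_eq_neg.1 h, Int.units_ne_iff_eq_neg.1 h']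
    decide
  have h := (p.2 (i + 1)).2.2
  rw [hsign, hsign, one_mul] at h
  exact Prod.ext (eq_one_of_isOfFinOrder_of_dihedralSign (hfst _) (hsign i))
    (eq_one_of_isOfFinOrder_of_dihedralSign (hsnd _) h)

theorem coherentSeq_int_eq_one (p : coherentSeq ℤ) (hp : IsOfFinOrder p) : p = 1 :=
  Subtype.ext <| funext fun i => by simpa using coherentSeq_apply_eq_one hp (i - 1)

/-- The shift dropping the initial term of a coherent sequence. -/
def coherentSeqTail : Monoid.End (coherentSeq ℕ) := coherentSeq.reindex (· + 1) fun _ => rfl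

theorem coherentSeqTail_eq_one (p : coherentSeq ℕ) (hp : IsOfFinOrder p) : coherentSeqTail p = 1 :=
  Subtype.ext <| funext <| coherentSeq_apply_eq_one hp

theorem iterate_coherentSeqTail_apply (m i : ℕ) (p : coherentSeq ℕ) :
    (coherentSeqTail^[m] p).1 i = p.1 (i + m) := by
  induction m generalizing p with
  | zero => rfl
  | succ m ih => exact (ih _).trans (congrArg p.1 (by simp only; omega))

/-- The restriction of a two-sided coherent sequence to the natural numbers. -/
def coherentSeqTrunc : coherentSeq ℤ →* coherentSeq ℕ :=
  coherentSeq.reindex (fun n => (n : ℤ)) fun _ => Int.natCast_succ _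

/-- The shift of two-sided coherent sequences. -/
def coherentSeqShift : MulAut (coherentSeq ℤ) :=
  MonoidHom.toMulEquiv (coherentSeq.reindex (· - 1) fun _ => by ring)
    (coherentSeq.reindex (· + 1) fun _ => rfl)
    (MonoidHom.ext fun p => Subtype.ext <| funext fun i => congrArg p.1 (add_sub_cancel_right i 1))
    (MonoidHom.ext fun p => Subtype.ext <| funext fun i => congrArg p.1 (sub_add_cancel i 1))

open DihedralGroup in
/-- The values of a coherent sequence supported at `-2` and `-1`. -/
def coherentSeqValue (j : ℤ) : DihedralGroup 0 × DihedralGroup 0 :=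
  if j = -1 then (sr 0, sr 0) else if j = -2 then (r 1, sr 1) else 1

theorem coherentSeqValue_of_ne {j : ℤ} (h1 : j ≠ -1) (h2 : j ≠ -2) : coherentSeqValue j = 1 := by
  simp [coherentSeqValue, h1, h2]

/-- A coherent sequence supported at `m - 2` and `m - 1`. -/
def coherentSeqBase (m : ℤ) : coherentSeq ℤ where
  val i := coherentSeqValue (i - m)
  property i := by
    simp only [show i + 1 - m = i - m + 1 by ring]
    generalize i - m = j
    obtain rfl | rfl | rfl | ⟨h1, h2, h3, h4⟩ : j = -1 ∨ j = -2 ∨ j = -3 ∨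
      (j ≠ -1 ∧ j ≠ -2 ∧ j + 1 ≠ -1 ∧ j + 1 ≠ -2) := by omega
    · decide
    · decide
    · decide
    · simp [coherentSeqValue_of_ne h1 h2, coherentSeqValue_of_ne h3 h4]

theorem coherentSeqShift_base (m : ℤ) :
    coherentSeqShift (coherentSeqBase m) = coherentSeqBase (m + 1) :=
  Subtype.ext <| funext fun i => congrArg coherentSeqValue (show i - 1 - m = i - (m + 1) by ring)

theorem invRel_coherentSeqBase (m : ℤ) :
    invRel (coherentSeqBase m) (coherentSeqBase (m + 1)) = 1 := by
  refine Subtype.ext <| funext fun i => ?_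
  change invRel (coherentSeqValue (i - m)) (coherentSeqValue (i - (m + 1))) = 1
  rw [show i - (m + 1) = i - m - 1 by ring]
  generalize i - m = j
  obtain rfl | rfl | ⟨h1, h2⟩ : j = -1 ∨ j = 0 ∨ (j - 1 ≠ -1 ∧ j - 1 ≠ -2) := by omega
  · decide
  · decide
  · simp [invRel, coherentSeqValue_of_ne h1 h2]

theorem coherentSeqTrunc_base_zero : coherentSeqTrunc (coherentSeqBase 0) = 1 :=
  Subtype.ext <| funext fun n =>
    show coherentSeqValue (n - 0) = 1 from coherentSeqValue_of_ne (by omega) (by omega)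

theorem iterate_coherentSeqTail_trunc_base (m : ℕ) :
    coherentSeqTail^[m] (coherentSeqTrunc (coherentSeqBase (m + 1))) ≠ 1 := by
  intro h
  have h1 := congrFun (congrArg Subtype.val h) 0
  rw [iterate_coherentSeqTail_apply, zero_add] at h1
  have h2 : coherentSeqValue ((m : ℤ) - (m + 1)) = 1 := h1
  rw [sub_add_cancel_left] at h2
  exact absurd h2 (by decide)

/-- Permutations of `ℤ × Bool`: the letter `true` acts as a translation, the letter `false` swaps
the two points over `0`. -/
def swapShift : FreeGroup Bool →* Equiv.Perm (ℤ × Bool) :=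
  FreeGroup.lift fun
    | true => (Equiv.addRight 1).prodCongr (Equiv.refl Bool)
    | false => Equiv.swap (0, false) (0, true)

theorem swapShift_inv_true_pow_apply (m : ℕ) (n : ℤ) (b : Bool) :
    (swapShift (.of true ^ m))⁻¹ (n, b) = (n - m, b) := by
  rw [Equiv.Perm.inv_eq_iff_eq]
  induction m generalizing n with
  | zero => simp
  | succ m ih =>
    have h : swapShift (.of true) (n - (m + 1 : ℕ), b) = (n - m, b) := by
      simp only [swapShift, FreeGroup.lift_apply_of, Equiv.prodCongr_apply, Prod.map_apply,
        Equiv.coe_addRight, Equiv.refl_apply, Nat.cast_add, Nat.cast_one]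
      rw [sub_add_eq_sub_sub, sub_add_cancel]
    rw [pow_succ, map_mul, Equiv.Perm.mul_apply, h]
    exact ih n

/-- The permutational wreath product of `N` with the free group of rank two acting through
`swapShift`. -/
abbrev SwapShiftWreath (N : Type*) [Group N] : Type _ :=
  ((ℤ × Bool) → N) ⋊[(arrowAut (Equiv.Perm (ℤ × Bool)) (ℤ × Bool) N).comp swapShift] FreeGroup Bool

namespace SwapShiftWreath

variable {N : Type*} [Group N]

/-- An element of the top group. -/
abbrev top (N : Type*) [Group N] (w : FreeGroup Bool) : SwapShiftWreath N :=
  SemidirectProduct.inr w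

/-- An element of the base group. -/
abbrev base (f : ℤ × Bool → N) : SwapShiftWreath N := SemidirectProduct.inl f

/-- The function with values `q (-n)` at `(n, false)` and trivial values at `(n, true)`. -/
def spread (q : ℤ → N) : ℤ × Bool → N := fun ω => if ω.2 then 1 else q (-ω.1)

/-- The function with values `p⁻¹` at `(0, false)`, `p` at `(0, true)` and trivial elsewhere. -/
def pair (p : N) : ℤ × Bool → N := fun ω => if ω.1 = 0 then if ω.2 then p else p⁻¹ else 1

theorem top_mul_base_mul_inv (w : FreeGroup Bool) (f : ℤ × Bool → N) :
    top N w * base f * (top N w)⁻¹ = base fun ω => f ((swapShift w)⁻¹ ω) := by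
  rw [← map_inv]
  exact (SemidirectProduct.inl_aut w f).symm

theorem shiftComm_spread (q : ℤ → N) (m : ℕ) :
    shiftComm (top N (.of false)) (base (spread q)) (top N (.of true)) m = base (pair (q m)) := by
  have h : (swapShift (.of false))⁻¹ = Equiv.swap (0, false) (0, true) := by simp [swapShift]
  rw [shiftComm, ← map_pow, top_mul_base_mul_inv, commutatorElement_def, top_mul_base_mul_inv, h,
    ← map_inv SemidirectProduct.inl, ← map_mul SemidirectProduct.inl]
  refine congrArg _ (funext fun ⟨n, b⟩ => ?_)
  simp only [Pi.mul_apply, Pi.inv_apply]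
  obtain rfl | hn := eq_or_ne n 0
  · cases b
    · rw [Equiv.swap_apply_left, swapShift_inv_true_pow_apply, swapShift_inv_true_pow_apply]
      simp [spread, pair]
    · rw [Equiv.swap_apply_right, swapShift_inv_true_pow_apply, swapShift_inv_true_pow_apply]
      simp [spread, pair]
  · rw [Equiv.swap_apply_of_ne_of_ne (by simp [hn]) (by simp [hn])]
    simp [pair, hn]

theorem invRel_base_pair {p q : N} (h : invRel p q = 1) :
    invRel (base (pair p)) (base (pair q)) = 1 := by
  rw [← map_invRel]
  refine (congrArg _ (funext fun ⟨n, b⟩ => ?_)).trans (map_one _)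
  change invRel (pair p (n, b)) (pair q (n, b)) = 1
  obtain rfl | hn := eq_or_ne n 0
  · cases b
    · have h1 : p * q ^ 2 * p⁻¹ = (q ^ 2)⁻¹ := eq_inv_of_mul_eq_one_left h
      calc p⁻¹ * q⁻¹ ^ 2 * p⁻¹⁻¹ * q⁻¹ ^ 2 = p⁻¹ * (q ^ 2)⁻¹ * p * q⁻¹ ^ 2 := by group
        _ = 1 := by rw [← h1]; group
    · simpa [pair] using h
  · simp [pair, hn, invRel]

theorem commutator_base_const_top (n : N) (w : FreeGroup Bool) :
    ⁅base fun _ => n, top N w⁆ = 1 := by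
  rw [commutatorElement_eq_one_iff_mul_comm]
  exact (mul_inv_eq_iff_eq_mul.1 (top_mul_base_mul_inv w fun _ => n)).symm

/-- The endomorphism induced by an endomorphism of `N`. -/
def mapBase (τ : Monoid.End N) : Monoid.End (SwapShiftWreath N) :=
  SemidirectProduct.map (MonoidHom.compLeft τ _) (MonoidHom.id _) fun _ => rfl

theorem mapBase_eq_one {τ : Monoid.End N} (hτ : ∀ n : N, IsOfFinOrder n → τ n = 1)
    (w : SwapShiftWreath N) (hw : IsOfFinOrder w) : mapBase τ w = 1 := by
  obtain ⟨h1, h2⟩ := right_eq_one_and_isOfFinOrder_left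
    (fun _ h => (isOfFinOrder_iff_eq_one _).1 h) hw
  exact SemidirectProduct.ext (funext fun ω => hτ _ (isOfFinOrder_apply h2 ω)) h1

theorem iterate_mapBase_left (τ : Monoid.End N) (m : ℕ) (w : SwapShiftWreath N) (ω : ℤ × Bool) :
    ((mapBase τ)^[m] w).left ω = τ^[m] (w.left ω) :=
  Function.Semiconj.iterate_right (f := fun w : SwapShiftWreath N => w.left ω) (ga := mapBase τ)
    (gb := τ) (fun _ => rfl) m w

end SwapShiftWreath

/-- The two-sided coherent sequences, extended by their shift. -/
abbrev ShiftedCoherentSeq : Type :=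
  coherentSeq ℤ ⋊[zpowersHom (MulAut (coherentSeq ℤ)) coherentSeqShift] Multiplicative ℤ

theorem shiftedCoherentSeq_eq_one (w : ShiftedCoherentSeq) (hw : IsOfFinOrder w) : w = 1 := by
  obtain ⟨h1, h2⟩ := right_eq_one_and_isOfFinOrder_left
    (fun _ h => (isOfFinOrder_iff_eq_one _).1 h) hw
  exact SemidirectProduct.ext (coherentSeq_int_eq_one _ h2) h1

/-- The truncation of the sequences, as a map which is equivariant for `SwapShiftWreath`. -/
def truncWreath (w : SwapShiftWreath ShiftedCoherentSeq) : SwapShiftWreath (coherentSeq ℕ) :=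
  ⟨fun ω => coherentSeqTrunc (w.left ω).left, w.right⟩

open SwapShiftWreath

theorem truncWreath_top_mul (v : FreeGroup Bool) (w : SwapShiftWreath ShiftedCoherentSeq) :
    truncWreath (top _ v * w) = top _ v * truncWreath w := by
  refine SemidirectProduct.ext (funext fun ω => ?_) rfl
  simp [truncWreath]

theorem truncWreath_base_mul (q : ℤ → coherentSeq ℤ) (w : SwapShiftWreath ShiftedCoherentSeq) :
    truncWreath (base (spread fun n => SemidirectProduct.inl (q n)) * w) =
      base (spread fun n => coherentSeqTrunc (q n)) * truncWreath w := by
  refine SemidirectProduct.ext (funext fun ω => ?_) ?_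
  · obtain ⟨n, b⟩ := ω
    cases b <;> simp [truncWreath, spread]
  · simp [truncWreath]

theorem inr_mul_inl_coherentSeqBase_mul_inv (m : ℤ) :
    (SemidirectProduct.inr (Multiplicative.ofAdd 1) : ShiftedCoherentSeq) *
      SemidirectProduct.inl (coherentSeqBase m) *
      (SemidirectProduct.inr (Multiplicative.ofAdd 1))⁻¹ =
      SemidirectProduct.inl (coherentSeqBase (m + 1)) := by
  rw [← coherentSeqShift_base, ← map_inv]
  refine (SemidirectProduct.inl_aut _ _).symm.trans ?_
  simp

theorem conj_spread_coherentSeqBase :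
    base (fun _ => (SemidirectProduct.inr (Multiplicative.ofAdd 1) : ShiftedCoherentSeq)) *
      base (spread fun n => SemidirectProduct.inl (coherentSeqBase n)) *
      (base fun _ => SemidirectProduct.inr (Multiplicative.ofAdd 1))⁻¹ =
    top _ (.of true) * base (spread fun n => SemidirectProduct.inl (coherentSeqBase n)) *
      (top _ (.of true))⁻¹ := by
  rw [top_mul_base_mul_inv, ← map_inv SemidirectProduct.inl, ← map_mul SemidirectProduct.inl,
    ← map_mul SemidirectProduct.inl]
  refine congrArg _ (funext fun ⟨n, b⟩ => ?_)
  rw [← pow_one (FreeGroup.of true), swapShift_inv_true_pow_apply]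
  cases b
  · simp only [Pi.mul_apply, Pi.inv_apply, spread, Bool.false_eq_true, if_false]
    rw [inr_mul_inl_coherentSeqBase_mul_inv]
    congr 2
    push_cast
    ring
  · simp [spread]

/-- Theorem: there is a finitely presented group `F` of torsion length `ω`, i.e. whose
torsion chain `tor_m(F)` is strictly increasing. -/
theorem exists_finitely_presented_torlen_omega :
    ∃ (k : ℕ) (R : Finset (FreeGroup (Fin k))),
      ∀ m : ℕ,
        tor (PresentedGroup (R : Set (FreeGroup (Fin k)))) m <
          tor (PresentedGroup (R : Set (FreeGroup (Fin k)))) (m + 1) := by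
  refine ⟨5, towerRelators, tor_lt_tor_succ_of_wreath (K := SwapShiftWreath ShiftedCoherentSeq)
    (P := SwapShiftWreath (coherentSeq ℕ))
    (x := top _ (.of false))
    (y := base (spread fun n => SemidirectProduct.inl (coherentSeqBase n)))
    (a := top _ (.of true))
    (s := base fun _ => SemidirectProduct.inr (Multiplicative.ofAdd 1))
    (x' := top _ (.of false))
    (y' := base (spread fun n => coherentSeqTrunc (coherentSeqBase n)))
    (a' := top _ (.of true))
    truncWreath (commutator_base_const_top _ _) (commutator_base_const_top _ _) ?_ ?_
    (truncWreath_top_mul _) (truncWreath_base_mul _) (truncWreath_top_mul _) ?_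
    (eq_one_of_isOfFinOrder_wreath shiftedCoherentSeq_eq_one
      fun _ h => (isOfFinOrder_iff_eq_one _).1 h)
    (mapBase_eq_one coherentSeqTail_eq_one) ?_⟩
  · exact mul_inv_eq_one.2 conj_spread_coherentSeqBase
  · rw [shiftComm_spread, shiftComm_spread]
    refine invRel_base_pair ?_
    rw [← map_invRel, Nat.cast_zero, Nat.cast_one, ← zero_add (1 : ℤ), invRel_coherentSeqBase,
      map_one]
  · rw [shiftComm_spread, Nat.cast_zero, coherentSeqTrunc_base_zero]
    exact (congrArg _ (funext fun ⟨n, b⟩ => by simp [pair])).trans (map_one _)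
  · intro m h
    have := congrArg (fun w => w.left (0, true)) h
    rw [shiftComm_spread] at this
    simp only [iterate_mapBase_left] at this
    refine iterate_coherentSeqTail_trunc_base m (Eq.trans ?_ this)
    simp [pair]
end
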